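/- arXiv:2407.12439 — 2 statements merged into one kernel-verified Lean document; each statement's English description precedes it below -/
import Mathlib

section
/- Let s, α ∈ (0,1) and p ≥ 1 with n > sp, and let Ω ⊂ ℝ^{n+1} be an open convex set. Let u ∈ L^∞(∂Ω, ℋ^n) be a non-negative function with compact support, and for i ∈ ℤ set a_i := ℋ^n({ x ∈ ∂Ω : u(x) > 2^i }). Then there is a constant c > 0 depending only on n, α, s, and p (in particular independent of Ω and u) such that (1/2) ∫_{∂Ω}∫_{∂Ω} |u(x)−u(y)|^p / |x−y|^{n+sp} dℋ^n(x)dℋ^n(y) + ∫_{∂Ω} H_α(x)^{sp/α} u(x)^p dℋ^n(x) ≥ c ∑_{i∈ℤ, a_{i−1} ≠ 0} 2^{pi} a_{i−1}^{−sp/n} a_i. -/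
open MeasureTheory Metric Filter
open scoped ENNReal NNReal Topology

/-- The fractional `α`-mean curvature of a set `Ω ⊆ ℝ^{n+1}` at a point `x`, defined as the
principal-value limit `lim_{ε→0⁺} (α/2) ∫_{ℝ^{n+1}∖B_ε(x)} (χ_{Ωᶜ}(y) − χ_Ω(y)) |y−x|^{-(n+1+α)} dy`
(realized as a `limsup`, with values in `[0,∞]`). -/
noncomputable def fracMeanCurv (n : ℕ) (α : ℝ) (Ω : Set (EuclideanSpace ℝ (Fin (n+1))))
    (x : EuclideanSpace ℝ (Fin (n+1))) : ℝ≥0∞ :=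
  Filter.limsup
    (fun ε : ℝ => ENNReal.ofReal
      (α / 2 * ∫ y in (Metric.ball x ε)ᶜ,
        (Set.indicator Ωᶜ (fun _ => (1:ℝ)) y - Set.indicator Ω (fun _ => (1:ℝ)) y)
          * ‖y - x‖ ^ (-((n:ℝ) + 1 + α))))
    (𝓝[>] (0:ℝ))

lemma geom_aux (n : ℕ) (Ω : Set (EuclideanSpace ℝ (Fin (n+1)))) (hO : IsOpen Ω)
    (hC : Convex ℝ Ω) (x : EuclideanSpace ℝ (Fin (n+1))) (hx : x ∈ frontier Ω) (r : ℝ) :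
    volume (Ω ∩ ball x r) ≤ ENNReal.ofReal (2 * r) * μH[(n:ℝ)] (frontier Ω ∩ ball x r) := by
  have hxO : x ∉ Ω := by
    rw [hO.frontier_eq] at hx; exact hx.2
  obtain ⟨y0, hy0⟩ : Ω.Nonempty := by
    rw [Set.nonempty_iff_ne_empty]; rintro rfl; simp at hx
  obtain ⟨f, hf⟩ := geometric_hahn_banach_open_point hC hO hxO
  set v0 := (InnerProductSpace.toDual ℝ (EuclideanSpace ℝ (Fin (n+1)))).symm f with hv0
  have hfv : ∀ y, f y = inner ℝ v0 y := fun y => by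
    rw [hv0, InnerProductSpace.toDual_symm_apply]
  have hv0n : v0 ≠ 0 := by
    intro h
    have := hf y0 hy0
    rw [hfv, hfv, h] at this
    simp at this
  have hvpos : 0 < ‖v0‖ := norm_pos_iff.2 hv0n
  set ν := ‖v0‖⁻¹ • v0 with hν
  have hνn : ‖ν‖ = 1 := by
    rw [hν, norm_smul, norm_inv, norm_norm, inv_mul_cancel₀ hvpos.ne']
  obtain ⟨b, hb⟩ := Orthonormal.exists_orthonormalBasis_extension_of_card_eq (𝕜 := ℝ)
    (E := EuclideanSpace ℝ (Fin (n+1))) (ι := Fin (n+1)) (by simp)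
    (v := fun _ => ν) (s := {0}) (by
      constructor
      · intro i; simpa using hνn
      · intro i j hij
        exact absurd (Subsingleton.elim i j) hij)
  have hb0 : b 0 = ν := hb 0 rfl
  have hneg : ∀ y ∈ Ω, inner ℝ ν (y - x) < 0 := by
    intro y hy
    have := hf y hy
    rw [hfv, hfv] at this
    rw [hν, inner_smul_left, inner_sub_right]
    have h2 : 0 < ‖v0‖⁻¹ := inv_pos.2 hvpos
    simp only [conj_trivial]
    exact mul_neg_of_pos_of_neg h2 (by linarith)
  -- the projection
  let T : EuclideanSpace ℝ (Fin (n+1)) → (Fin n → ℝ) := fun y i => b.repr y i.succ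
  have hT : LipschitzWith 1 T := by
    apply LipschitzWith.of_dist_le_mul
    intro y z
    rw [NNReal.coe_one, one_mul, dist_pi_le_iff dist_nonneg]
    intro i
    have h1 : dist (b.repr y) (b.repr z) = dist y z := b.repr.dist_map y z
    rw [← h1, dist_eq_norm, dist_eq_norm]
    exact PiLp.norm_apply_le (b.repr y - b.repr z) i.succ
  have hΦ : MeasurePreserving (fun y : EuclideanSpace ℝ (Fin (n+1)) =>
      ((b.repr y 0, T y) : ℝ × (Fin n → ℝ))) volume volume := by
    have := (volume_preserving_piFinSuccAbove (fun _ : Fin (n+1) => ℝ) 0).comp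
      ((PiLp.volume_preserving_ofLp (Fin (n+1))).comp b.measurePreserving_repr)
    exact this
  set Z := frontier Ω ∩ ball x r
  have hcross : T '' (Ω ∩ ball x r) ⊆ T '' Z := by
    rintro _ ⟨y, ⟨hy, hyr⟩, rfl⟩
    set t := inner ℝ ν (y - x) with ht
    set y' := y - t • ν with hy'
    have hy'O : y' ∉ Ω := by
      intro h
      have := hneg y' h
      have h3 : y' - x = (y - x) - t • ν := by rw [hy']; abel
      rw [h3, inner_sub_right, inner_smul_right, real_inner_self_eq_norm_sq, hνn] at this
      simp [← ht] at this
    have hy'r : y' ∈ ball x r := by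
      rw [mem_ball, dist_eq_norm] at hyr ⊢
      refine lt_of_le_of_lt ?_ hyr
      have h3 : y' - x = (y - x) - t • ν := by rw [hy']; abel
      have h4 : ‖y' - x‖ ^ 2 ≤ ‖y - x‖ ^ 2 := by
        rw [h3, norm_sub_sq_real, inner_smul_right, real_inner_comm, ← ht, norm_smul, hνn]
        have : (‖t‖ * 1)^2 = t^2 := by simp
        rw [this]; nlinarith [sq_nonneg t]
      exact le_of_sq_le_sq h4 (norm_nonneg _)
    have hseg : IsPreconnected (segment ℝ y y') := (convex_segment y y').isPreconnected
    obtain ⟨z, hzs, hz⟩ : (segment ℝ y y' ∩ frontier Ω).Nonempty := by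
      by_contra hcon
      rw [Set.not_nonempty_iff_eq_empty] at hcon
      have := hseg.subset_or_subset (u := Ω) (v := (closure Ω)ᶜ) hO isClosed_closure.isOpen_compl
        (by rw [Set.disjoint_compl_right_iff_subset]; exact subset_closure)
        (by
          intro w hw
          by_contra h
          simp only [Set.mem_union, Set.mem_compl_iff, not_or, not_not] at h
          have : w ∈ segment ℝ y y' ∩ frontier Ω := ⟨hw, by rw [hO.frontier_eq]; exact ⟨h.2, h.1⟩⟩
          rw [hcon] at this; exact this)
      rcases this with h | h
      · exact hy'O (h (right_mem_segment ℝ y y'))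
      · exact h (left_mem_segment ℝ y y') (subset_closure hy)
    refine ⟨z, ⟨hz, (convex_ball x r).segment_subset hyr hy'r hzs⟩, ?_⟩
    obtain ⟨c, d, -, -, hcd, rfl⟩ := hzs
    have : c • y + d • y' = y - (d * t) • b 0 := by
      rw [hb0, hy', smul_sub, ← add_sub_assoc, ← add_smul, hcd, one_smul, smul_smul]
    rw [this]
    ext i
    simp [T]
  set W := toMeasurable volume (T '' Z)
  have hsub : Ω ∩ ball x r ⊆ (fun y : EuclideanSpace ℝ (Fin (n+1)) =>
      ((b.repr y 0, T y) : ℝ × (Fin n → ℝ))) ⁻¹'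
        (Set.Ioo (b.repr x 0 - r) (b.repr x 0 + r) ×ˢ W) := by
    intro y hy
    refine ⟨?_, subset_toMeasurable _ _ (hcross ⟨y, hy, rfl⟩)⟩
    have h1 : dist (b.repr y) (b.repr x) = dist y x := b.repr.dist_map y x
    have h2 : dist y x < r := hy.2
    have h3 := PiLp.norm_apply_le (b.repr y - b.repr x) 0
    rw [← h1, dist_eq_norm] at h2
    have h4 := lt_of_le_of_lt h3 h2
    rw [PiLp.sub_apply, Real.norm_eq_abs, abs_lt] at h4
    constructor <;> simp only <;> linarith [h4.1, h4.2]
  calc volume (Ω ∩ ball x r) ≤ _ := measure_mono hsub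
    _ = volume (Set.Ioo (b.repr x 0 - r) (b.repr x 0 + r) ×ˢ W) :=
        hΦ.measure_preimage (measurableSet_Ioo.prod (measurableSet_toMeasurable _ _)).nullMeasurableSet
    _ = ENNReal.ofReal (2 * r) * volume (T '' Z) := by
        rw [Measure.volume_eq_prod, Measure.prod_prod, Real.volume_Ioo, measure_toMeasurable]
        congr 2; ring
    _ ≤ _ := by
        gcongr
        rw [← hausdorffMeasure_pi_real]
        have := hT.hausdorffMeasure_image_le (d := (n:ℝ)) (by positivity) Z
        simpa using this

lemma curv_aux (n : ℕ) (hn : 1 ≤ n) (α : ℝ) (hα : 0 < α)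
    (Ω : Set (EuclideanSpace ℝ (Fin (n+1)))) (hO : IsOpen Ω)
    (hC : Convex ℝ Ω) (x : EuclideanSpace ℝ (Fin (n+1))) (hx : x ∈ frontier Ω) (r : ℝ)
    (hr : 0 < r) (V : ℝ) (hV : V = volume.real (ball (0 : EuclideanSpace ℝ (Fin (n+1))) 1))
    (hvol : volume.real (Ω ∩ ball x r) ≤ V * r ^ (n+1) / 4) :
    ENNReal.ofReal (α * V / 8 * r ^ (-α)) ≤ fracMeanCurv n α Ω x := by
  have hxO : x ∉ Ω := by
    rw [hO.frontier_eq] at hx; exact hx.2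
  have hV0 : 0 ≤ V := by rw [hV]; positivity
  have hball : ∀ ρ : ℝ, 0 ≤ ρ → volume.real (ball x ρ) = V * ρ ^ (n+1) := by
    intro ρ hρ
    rw [measureReal_def, Measure.addHaar_ball _ _ hρ, hV, measureReal_def, ENNReal.toReal_mul,
      ENNReal.toReal_ofReal (by positivity)]
    simp [mul_comm]
  unfold fracMeanCurv
  refine le_trans ?_ (liminf_le_limsup (by isBoundedDefault) (by isBoundedDefault))
  refine le_liminf_of_le (by isBoundedDefault) ?_
  have hev : ∀ᶠ ε : ℝ in 𝓝[>] (0:ℝ), ε ∈ Set.Ioo 0 (r/2) := Ioo_mem_nhdsGT (by positivity)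
  filter_upwards [hev] with ε hε
  apply ENNReal.ofReal_le_ofReal
  set q : ℝ := (n:ℝ) + 1 + α with hq
  have hqn : -q ≤ 0 := by
    have : (0:ℝ) ≤ n := by positivity
    rw [hq]; linarith
  set f : EuclideanSpace ℝ (Fin (n+1)) → ℝ := fun y =>
    (Set.indicator Ωᶜ (fun _ => (1:ℝ)) y - Set.indicator Ω (fun _ => (1:ℝ)) y) with hf
  have hfm : Measurable f := by
    apply Measurable.sub
    · exact measurable_const.indicator hO.measurableSet.compl
    · exact measurable_const.indicator hO.measurableSet
  have hf1 : ∀ y ∈ Ω, f y = -1 := fun y hy => by simp [hf, hy]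
  have hf2 : ∀ y, y ∉ Ω → f y = 1 := fun y hy => by simp [hf, hy]
  have hfb : ∀ y, |f y| ≤ 1 := fun y => by
    by_cases h : y ∈ Ω
    · simp [hf1 y h]
    · simp [hf2 y h]
  have hsym : ∀ y, 0 ≤ f y + f (x + x - y) := by
    intro y
    by_cases h : y ∈ Ω
    · by_cases h' : x + x - y ∈ Ω
      · exfalso
        apply hxO
        have := hC h h' (a := 1/2) (b := 1/2) (by norm_num) (by norm_num) (by norm_num)
        convert this using 1
        rw [← smul_add, add_sub_cancel, ← two_smul ℝ x, smul_smul]; norm_num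
      · rw [hf1 y h, hf2 _ h']; norm_num
    · by_cases h' : x + x - y ∈ Ω
      · rw [hf2 y h, hf1 _ h']; norm_num
      · rw [hf2 y h, hf2 _ h']; norm_num
  set F : EuclideanSpace ℝ (Fin (n+1)) → ℝ :=
    (ball x ε)ᶜ.indicator (fun y => f y * ‖y - x‖ ^ (-q)) with hF
  set G : EuclideanSpace ℝ (Fin (n+1)) → ℝ :=
    (ball x r \ ball x ε).indicator (fun y => f y * r ^ (-q)) with hG
  have hkm : Measurable (fun y : EuclideanSpace ℝ (Fin (n+1)) => ‖y - x‖ ^ (-q)) := by fun_prop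
  have hFi : Integrable F := by
    have h1 : Integrable (fun y : EuclideanSpace ℝ (Fin (n+1)) =>
        (1/ε + 1) ^ q * (1 + ‖y - x‖) ^ (-q)) := by
      apply Integrable.const_mul
      have := integrable_one_add_norm (E := EuclideanSpace ℝ (Fin (n+1))) (μ := volume) (r := q)
        (by rw [hq]; simp; linarith)
      exact this.comp_sub_right x
    refine h1.mono' ((hfm.mul hkm).indicator measurableSet_ball.compl).aestronglyMeasurable ?_
    filter_upwards with y
    by_cases hy : y ∈ (ball x ε)ᶜ
    · rw [hF, Set.indicator_of_mem hy, norm_mul]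
      have hd : ε ≤ ‖y - x‖ := by simpa [dist_eq_norm] using hy
      have hdp : 0 < ‖y - x‖ := lt_of_lt_of_le hε.1 hd
      have h2 : 1 + ‖y - x‖ ≤ (1/ε + 1) * ‖y - x‖ := by
        have : 1 ≤ 1/ε * ‖y - x‖ := by
          rw [div_mul_eq_mul_div, one_mul, le_div_iff₀ hε.1]; linarith
        linarith
      have hε' := hε.1
      have h3 : ((1/ε + 1) * ‖y - x‖) ^ (-q) ≤ (1 + ‖y - x‖) ^ (-q) :=
        Real.rpow_le_rpow_of_nonpos (by positivity) h2 hqn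
      rw [Real.mul_rpow (by positivity) (by positivity)] at h3
      have h4 : ‖y - x‖ ^ (-q) = (1/ε + 1) ^ q * ((1/ε + 1) ^ (-q) * ‖y - x‖ ^ (-q)) := by
        rw [← mul_assoc, ← Real.rpow_add (by positivity)]; simp
      have h5 : ‖‖y - x‖ ^ (-q)‖ = ‖y - x‖ ^ (-q) := by
        rw [Real.norm_of_nonneg]; positivity
      rw [h5]
      calc ‖f y‖ * ‖y - x‖ ^ (-q) ≤ 1 * ‖y - x‖ ^ (-q) := by
            gcongr; exact hfb y
        _ = (1/ε + 1) ^ q * ((1/ε + 1) ^ (-q) * ‖y - x‖ ^ (-q)) := by rw [one_mul]; exact h4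
        _ ≤ _ := by gcongr
    · rw [hF, Set.indicator_of_notMem hy]
      have hε' := hε.1
      simp only [norm_zero]; positivity
  have hSm : MeasurableSet (ball x r \ ball x ε) := measurableSet_ball.diff measurableSet_ball
  have hSfin : volume (ball x r \ ball x ε) ≠ ⊤ :=
    measure_ne_top_of_subset Set.sdiff_subset measure_ball_lt_top.ne
  have hfi : IntegrableOn f (ball x r \ ball x ε) := by
    refine Measure.integrableOn_of_bounded (M := 1) hSfin hfm.aestronglyMeasurable ?_
    filter_upwards with y using hfb y
  have hGi : Integrable G := by
    rw [hG, integrable_indicator_iff hSm]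
    exact hfi.mul_const _
  have hle : ∫ y, G y ≤ ∫ y, F y := by
    have hD : Integrable (fun y => F y - G y) := hFi.sub hGi
    have hDr : Integrable (fun y => F (x + x - y) - G (x + x - y)) := hD.comp_sub_left (x + x)
    have e1 : ∫ y, (F (x + x - y) - G (x + x - y)) = ∫ y, (F y - G y) :=
      integral_sub_left_eq_self (fun y => F y - G y) volume (x + x)
    have h0 : 0 ≤ ∫ y, ((F y - G y) + (F (x + x - y) - G (x + x - y))) := by
      apply integral_nonneg
      intro y
      simp only [Pi.zero_apply]
      have hn' : ‖x + x - y - x‖ = ‖y - x‖ := by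
        rw [← norm_neg]; congr 1; abel
      have hm : ∀ ρ, x + x - y ∈ ball x ρ ↔ y ∈ ball x ρ := by
        intro ρ; rw [mem_ball, mem_ball, dist_eq_norm, dist_eq_norm, hn']
      by_cases h1 : y ∈ ball x ε
      · have h1' := (hm ε).2 h1
        simp [hF, hG, h1, h1']
      · have h1' : x + x - y ∉ ball x ε := fun h => h1 ((hm ε).1 h)
        have hd : ε ≤ ‖y - x‖ := by simpa [dist_eq_norm] using h1
        have hdp : 0 < ‖y - x‖ := lt_of_lt_of_le hε.1 hd
        by_cases h2 : y ∈ ball x r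
        · have h2' := (hm r).2 h2
          have hlt : ‖y - x‖ < r := by simpa [dist_eq_norm] using h2
          have hk : r ^ (-q) ≤ ‖y - x‖ ^ (-q) :=
            Real.rpow_le_rpow_of_nonpos hdp hlt.le hqn
          simp only [hF, hG, Set.indicator, Set.mem_compl_iff, h1, h1', h2, h2', Set.mem_sdiff,
            not_false_eq_true, and_self, if_true, hn']
          have := mul_nonneg (hsym y) (sub_nonneg.2 hk)
          nlinarith
        · have h2' : x + x - y ∉ ball x r := fun h => h2 ((hm r).1 h)
          simp only [hF, hG, Set.indicator, Set.mem_compl_iff, h1, h1', h2, h2', Set.mem_sdiff,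
            not_false_eq_true, false_and, if_true, if_false, hn']
          have := mul_nonneg (hsym y) (Real.rpow_nonneg hdp.le (-q))
          nlinarith
    rw [integral_add hD hDr, e1, integral_sub hFi hGi] at h0
    linarith
  have hFeq : ∫ y, F y = ∫ y in (ball x ε)ᶜ, f y * ‖y - x‖ ^ (-q) :=
    integral_indicator measurableSet_ball.compl
  have hGeq : ∫ y, G y = (∫ y in ball x r \ ball x ε, f y) * r ^ (-q) := by
    rw [hG, integral_indicator hSm, integral_mul_const]
  have hfe : f = fun y => 1 - 2 * Ω.indicator (fun _ => (1:ℝ)) y := by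
    ext y
    by_cases h : y ∈ Ω
    · rw [hf1 y h]; simp [h]; norm_num
    · rw [hf2 y h]; simp [h]
  have hfint : ∫ y in ball x r \ ball x ε, f y =
      volume.real (ball x r \ ball x ε) - 2 * volume.real (Ω ∩ (ball x r \ ball x ε)) := by
    have hi2 : IntegrableOn (Ω.indicator (fun _ => (1:ℝ))) (ball x r \ ball x ε) :=
      (integrableOn_const hSfin).indicator hO.measurableSet
    have hi1 : IntegrableOn (fun _ : EuclideanSpace ℝ (Fin (n+1)) => (1:ℝ)) (ball x r \ ball x ε) :=
      integrableOn_const hSfin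
    rw [hfe, integral_sub hi1 (hi2.const_mul 2), integral_const_mul,
      integral_indicator hO.measurableSet, Measure.restrict_restrict hO.measurableSet]
    simp
  have hlow : V * r ^ (n+1) / 4 ≤ ∫ y in ball x r \ ball x ε, f y := by
    rw [hfint]
    have h1 : volume.real (Ω ∩ (ball x r \ ball x ε)) ≤ volume.real (Ω ∩ ball x r) :=
      measureReal_mono (Set.inter_subset_inter_right _ Set.sdiff_subset)
        (measure_ne_top_of_subset Set.inter_subset_right measure_ball_lt_top.ne)
    have h2 : volume.real (ball x r \ ball x ε) = V * r ^ (n+1) - V * ε ^ (n+1) := by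
      rw [measureReal_sdiff (ball_subset_ball (by linarith [hε.1, hε.2])) measurableSet_ball
        measure_ball_lt_top.ne,
        hball r hr.le, hball ε hε.1.le]
    have h3 : ε ^ (n+1) ≤ r ^ (n+1) / 4 := by
      calc ε ^ (n+1) ≤ (r/2) ^ (n+1) := pow_le_pow_left₀ hε.1.le hε.2.le _
        _ = r ^ (n+1) * (1/2) ^ (n+1) := by rw [← mul_pow]; ring
        _ ≤ r ^ (n+1) * (1/2) ^ 2 := by
            gcongr ?_ * ?_
            exact pow_le_pow_of_le_one (by norm_num) (by norm_num) (by omega)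
        _ = _ := by ring
    rw [h2]
    nlinarith
  have hrq : r ^ (n+1) * r ^ (-q) = r ^ (-α) := by
    rw [← Real.rpow_natCast, ← Real.rpow_add hr]; congr 1; rw [hq]; push_cast; ring
  calc α * V / 8 * r ^ (-α) = α / 2 * (V * r ^ (n+1) / 4 * r ^ (-q)) := by
        rw [← hrq]; ring
    _ ≤ α / 2 * ((∫ y in ball x r \ ball x ε, f y) * r ^ (-q)) := by
        gcongr
    _ ≤ _ := by
        rw [← hGeq]
        gcongr
        rw [← hFeq]; exact hle

lemma geo_aux (p : ℝ) (hp : 1 ≤ p) (t : ℝ) (ht : 0 ≤ t) :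
    ∑' i : ℤ, (if (2:ℝ) ^ i < t then (2:ℝ≥0∞) ^ (p * i) else 0) ≤ 2 * (ENNReal.ofReal t) ^ p := by
  rcases ht.eq_or_lt with rfl | ht
  · have : ∀ i : ℤ, ¬ ((2:ℝ) ^ i < 0) := fun i => not_lt.2 (by positivity)
    simp [this]
  obtain ⟨j, hj1, hj2⟩ := exists_mem_Ioc_zpow ht (one_lt_two)
  have hinj : Function.Injective (fun k : ℕ => j - (k:ℤ)) := by
    intro a b h; simpa using h
  rw [← hinj.tsum_eq]
  · calc ∑' k : ℕ, (if (2:ℝ) ^ (j - (k:ℤ)) < t then (2:ℝ≥0∞) ^ (p * ((j - (k:ℤ) : ℤ) : ℝ)) else 0)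
        ≤ ∑' k : ℕ, (ENNReal.ofReal t) ^ p * (2⁻¹) ^ k := by
          gcongr with k
          have h2 : (2:ℝ≥0∞) ^ (p * (j:ℝ)) ≤ ENNReal.ofReal t ^ p := by
            rw [mul_comm, ENNReal.rpow_mul]
            gcongr
            rw [ENNReal.rpow_intCast]
            have : (2:ℝ≥0∞) ^ j = ENNReal.ofReal ((2:ℝ) ^ j) := by
              rw [← ENNReal.rpow_intCast, ← Real.rpow_intCast, ← ENNReal.ofReal_rpow_of_pos (by norm_num)]; norm_num
            rw [this]
            exact ENNReal.ofReal_le_ofReal hj1.le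
          split_ifs
          · push_cast
            rw [mul_sub, sub_eq_add_neg, ENNReal.rpow_add _ _ (by norm_num) (by norm_num)]
            gcongr
            rw [← ENNReal.rpow_natCast, ← ENNReal.rpow_neg_one, ← ENNReal.rpow_mul]
            apply ENNReal.rpow_le_rpow_of_exponent_le (by norm_num)
            have : (0:ℝ) ≤ k := by positivity
            nlinarith
          · exact zero_le
      _ = 2 * (ENNReal.ofReal t) ^ p := by
          rw [ENNReal.tsum_mul_left, ENNReal.tsum_geometric, mul_comm]
          congr 1
          rw [ENNReal.one_sub_inv_two, inv_inv]
  · intro i hi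
    have h1 : (2:ℝ) ^ i < t := by
      by_contra h; simp [h] at hi
    have h2 : i < j + 1 := (zpow_lt_zpow_iff_right₀ one_lt_two).1 (h1.trans_le hj2)
    exact ⟨(j - i).toNat, by simp only; omega⟩

lemma case1_aux (n : ℕ) (hn : 1 ≤ n) (σ : ℝ) (hσ : 0 < σ)
    (Ω : Set (EuclideanSpace ℝ (Fin (n+1)))) (hO : IsOpen Ω)
    (hC : Convex ℝ Ω) (x : EuclideanSpace ℝ (Fin (n+1))) (hx : x ∈ frontier Ω)
    (V : ℝ) (hV : 0 < V) (m r : ℝ) (hr : 0 < r) (hm : m = V / 16 * r ^ n)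
    (E : Set (EuclideanSpace ℝ (Fin (n+1)))) (hE : MeasurableSet E)
    (hEm : μH[(n:ℝ)] E = ENNReal.ofReal m)
    (hvol : ENNReal.ofReal (V * r ^ (n+1) / 4) < volume (Ω ∩ ball x r)) :
    (ENNReal.ofReal m) ^ (-σ/(n:ℝ)) ≤ ENNReal.ofReal ((V/16) ^ (-σ/(n:ℝ) - 1)) *
      ∫⁻ y in frontier Ω, Eᶜ.indicator
        (fun y => ((‖x - y‖₊ : ℝ≥0∞) ^ ((n:ℝ) + σ))⁻¹) y ∂μH[(n:ℝ)] := by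
  have hn0 : (0:ℝ) < n := by exact_mod_cast hn
  have hmpos : 0 < m := by rw [hm]; positivity
  set Z := frontier Ω ∩ ball x r with hZ
  have hZm : MeasurableSet Z := isClosed_frontier.measurableSet.inter measurableSet_ball
  have h1 : ENNReal.ofReal (2 * m) ≤ μH[(n:ℝ)] Z := by
    have h := hvol.le.trans (geom_aux n Ω hO hC x hx r)
    have e : V * r ^ (n+1) / 4 = (2 * r) * (2 * m) := by rw [hm]; ring
    rw [e, ENNReal.ofReal_mul (by positivity)] at h
    exact (ENNReal.mul_le_mul_iff_right (by simpa using hr) ENNReal.ofReal_ne_top).1 h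
  have h2 : ENNReal.ofReal m ≤ μH[(n:ℝ)] (Z \ E) := by
    refine le_trans ?_ le_measure_sdiff
    rw [hEm]
    refine le_trans ?_ (tsub_le_tsub_right h1 _)
    rw [← ENNReal.ofReal_sub _ hmpos.le]
    apply ENNReal.ofReal_le_ofReal; linarith
  have h3 : ENNReal.ofReal (r ^ (-((n:ℝ) + σ))) * ENNReal.ofReal m ≤ ∫⁻ y in frontier Ω, Eᶜ.indicator
        (fun y => ((‖x - y‖₊ : ℝ≥0∞) ^ ((n:ℝ) + σ))⁻¹) y ∂μH[(n:ℝ)] := by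
    calc _ ≤ ENNReal.ofReal (r ^ (-((n:ℝ) + σ))) * (μH[(n:ℝ)].restrict (frontier Ω)) (Z \ E) := by
          gcongr
          rw [Measure.restrict_apply (hZm.diff hE),
            Set.inter_eq_left.2 (Set.sdiff_subset.trans Set.inter_subset_left)]
          exact h2
      _ = ∫⁻ y in frontier Ω, (Z \ E).indicator
            (fun _ => ENNReal.ofReal (r ^ (-((n:ℝ) + σ)))) y ∂μH[(n:ℝ)] := by
          rw [lintegral_indicator_const (hZm.diff hE)]
      _ ≤ _ := by
          apply lintegral_mono
          intro y
          by_cases hy : y ∈ Z \ E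
          · have hy2 : y ∈ Eᶜ := hy.2
            simp only [Set.indicator_of_mem hy, Set.indicator_of_mem hy2]
            rw [ENNReal.le_inv_iff_le_inv, ← ENNReal.ofReal_inv_of_pos (by positivity),
              ← Real.rpow_neg hr.le, neg_neg, ← ENNReal.ofReal_rpow_of_pos hr]
            gcongr
            have : ‖x - y‖ < r := by
              have := hy.1.2
              rwa [mem_ball, dist_comm, dist_eq_norm] at this
            rw [← enorm_eq_nnnorm, ← ofReal_norm]
            exact ENNReal.ofReal_le_ofReal this.le
          · simp [Set.indicator_of_notMem hy]
  refine le_trans (le_of_eq ?_) (mul_le_mul_right h3 _)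
  rw [ENNReal.ofReal_rpow_of_pos hmpos, ← ENNReal.ofReal_mul (by positivity),
    ← ENNReal.ofReal_mul (by positivity)]
  congr 1
  have e1 : m ^ (-σ/(n:ℝ)) = (V/16) ^ (-σ/(n:ℝ)) * r ^ (-σ) := by
    rw [hm, Real.mul_rpow (by positivity) (by positivity), ← Real.rpow_natCast, ← Real.rpow_mul hr.le]
    congr 2; field_simp
  have e2 : r ^ (-((n:ℝ) + σ)) * r ^ n = r ^ (-σ) := by
    rw [← Real.rpow_natCast, ← Real.rpow_add hr]; congr 1; ring
  have e3 : (V/16) ^ (-σ/(n:ℝ) - 1) * (V / 16) = (V/16) ^ (-σ/(n:ℝ)) := by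
    rw [Real.rpow_sub_one (by positivity)]; field_simp
  rw [e1, ← e2, ← e3, hm]; ring

lemma case2_aux (n : ℕ) (hn : 1 ≤ n) (α σ : ℝ) (hα : 0 < α) (hσ : 0 < σ)
    (V : ℝ) (hV : 0 < V) (m r : ℝ) (hr : 0 < r) (hm : m = V / 16 * r ^ n) (H : ℝ≥0∞)
    (hH : ENNReal.ofReal (α * V / 8 * r ^ (-α)) ≤ H) :
    (ENNReal.ofReal m) ^ (-σ/(n:ℝ)) ≤
      ENNReal.ofReal ((V/16) ^ (-σ/(n:ℝ)) * (α * V / 8) ^ (-(σ / α))) * H ^ (σ / α) := by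
  have hn0 : (0:ℝ) < n := by exact_mod_cast hn
  have hmpos : 0 < m := by rw [hm]; positivity
  have h := ENNReal.rpow_le_rpow hH (show 0 ≤ σ / α by positivity)
  refine le_trans (le_of_eq ?_) (mul_le_mul_right h _)
  rw [ENNReal.ofReal_rpow_of_pos hmpos, ENNReal.ofReal_rpow_of_pos (by positivity),
    ← ENNReal.ofReal_mul (by positivity)]
  congr 1
  have e1 : m ^ (-σ/(n:ℝ)) = (V/16) ^ (-σ/(n:ℝ)) * r ^ (-σ) := by
    rw [hm, Real.mul_rpow (by positivity) (by positivity), ← Real.rpow_natCast, ← Real.rpow_mul hr.le]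
    congr 2; field_simp
  have e2 : (α * V / 8 * r ^ (-α)) ^ (σ / α) = (α * V / 8) ^ (σ / α) * r ^ (-σ) := by
    rw [Real.mul_rpow (by positivity) (by positivity), ← Real.rpow_mul hr.le]
    congr 2; field_simp
  have e3 : (α * V / 8) ^ (-(σ / α)) * (α * V / 8) ^ (σ / α) = 1 := by
    rw [← Real.rpow_add (by positivity)]; simp
  rw [e1, e2]
  calc _ = (V/16) ^ (-σ/(n:ℝ)) * 1 * r ^ (-σ) := by ring
    _ = _ := by rw [← e3]; ring

/-- Lower bound of the fractional energy on a convex hypersurface by the series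
`∑_{i : a_{i-1} ≠ 0} 2^{pi} a_{i-1}^{-sp/n} a_i` of the level-set measures
`a_i = ℋ^n({u > 2^i})`, with a universal constant. -/
theorem energy_lower_bound_levels
    (n : ℕ) (hn : 1 ≤ n) (α s p : ℝ)
    (hα : α ∈ Set.Ioo (0:ℝ) 1) (hs : s ∈ Set.Ioo (0:ℝ) 1)
    (hp : 1 ≤ p) (hsp : s * p < n) :
    ∃ c : ℝ≥0, 0 < c ∧
      ∀ (Ω : Set (EuclideanSpace ℝ (Fin (n+1)))), IsOpen Ω → Convex ℝ Ω →
      ∀ u : EuclideanSpace ℝ (Fin (n+1)) → ℝ,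
        Measurable u → (∀ x, 0 ≤ u x) → HasCompactSupport u →
        (∃ B : ℝ, ∀ x ∈ frontier Ω, u x ≤ B) →
        ∀ a : ℤ → ℝ≥0∞,
          (∀ i : ℤ, a i = μH[(n:ℝ)] {x ∈ frontier Ω | (2:ℝ) ^ i < u x}) →
          (c : ℝ≥0∞) * ∑' i : ℤ,
              (if a (i-1) ≠ 0 then
                (2:ℝ≥0∞) ^ (p * i) * a (i-1) ^ (-(s*p)/(n:ℝ)) * a i else 0)
            ≤ (1/2) * (∫⁻ x in frontier Ω, ∫⁻ y in frontier Ω,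
                  (‖u x - u y‖₊ : ℝ≥0∞) ^ p / (‖x - y‖₊ : ℝ≥0∞) ^ ((n:ℝ) + s*p)
                    ∂μH[(n:ℝ)] ∂μH[(n:ℝ)])
              + ∫⁻ x in frontier Ω,
                  (fracMeanCurv n α Ω x) ^ (s*p/α) * (‖u x‖₊ : ℝ≥0∞) ^ p ∂μH[(n:ℝ)] := by
  classical
  obtain ⟨hα0, -⟩ := hα
  have hσ : 0 < s * p := mul_pos hs.1 (by linarith)
  set σ := s * p with hσdef
  have hn0 : (0:ℝ) < n := by exact_mod_cast hn
  set V : ℝ := volume.real (ball (0 : EuclideanSpace ℝ (Fin (n+1))) 1) with hVdef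
  have hV : 0 < V := by
    rw [hVdef, measureReal_def]
    exact ENNReal.toReal_pos (measure_ball_pos _ _ one_pos).ne' measure_ball_lt_top.ne
  set k1 : ℝ := (V/16) ^ (-σ/(n:ℝ) - 1) with hk1
  set k2 : ℝ := (V/16) ^ (-σ/(n:ℝ)) * (α * V / 8) ^ (-(σ / α)) with hk2
  have hk1p : 0 < k1 := by positivity
  have hk2p : 0 < k2 := by positivity
  set C : ℝ := 4 * 2 ^ p * k1 + 2 * k2 with hCdef
  have hCp : 0 < C := by positivity
  refine ⟨(Real.toNNReal C)⁻¹, by simpa using hCp, ?_⟩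
  intro Ω hO hC u hu hu0 _ _ a ha
  set A : ℤ → Set (EuclideanSpace ℝ (Fin (n+1))) := fun i => {x ∈ frontier Ω | (2:ℝ) ^ i < u x}
    with hA
  have hFm : MeasurableSet (frontier Ω) := isClosed_frontier.measurableSet
  have hAm : ∀ i, MeasurableSet (A i) := fun i =>
    hFm.inter (measurableSet_lt measurable_const hu)
  set r : ℤ → ℝ := fun i => ((a (i-1)).toReal / (V/16)) ^ (1/(n:ℝ)) with hrdef
  set M : ℤ → Set (EuclideanSpace ℝ (Fin (n+1))) := fun i =>
    {x | ENNReal.ofReal (V * r i ^ (n+1) / 4) < volume (Ω ∩ ball x (r i))} with hM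
  have hMm : ∀ i, MeasurableSet (M i) := by
    intro i
    apply measurableSet_lt measurable_const
    have hS : MeasurableSet {q : EuclideanSpace ℝ (Fin (n+1)) × EuclideanSpace ℝ (Fin (n+1)) |
        q.2 ∈ Ω ∧ dist q.2 q.1 < r i} := by
      apply MeasurableSet.inter
      · exact measurable_snd hO.measurableSet
      · exact measurableSet_lt (measurable_snd.dist measurable_fst) measurable_const
    exact measurable_measure_prodMk_left (ν := volume) hS
  set w : ℤ → ℝ≥0∞ := fun i => if a (i-1) ≠ 0 then a (i-1) ^ (-σ/(n:ℝ)) else 0 with hw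
  have hmr : ∀ i, a (i-1) ≠ 0 → a (i-1) ≠ ⊤ → 0 < r i ∧ (a (i-1)).toReal = V / 16 * r i ^ n := by
    intro i h0 ht
    have hp' := ENNReal.toReal_pos h0 ht
    refine ⟨by simp only [hrdef]; positivity, ?_⟩
    simp only [hrdef]
    rw [← Real.rpow_natCast, ← Real.rpow_mul (by positivity)]
    have : 1 / (n:ℝ) * n = 1 := by field_simp
    rw [this, Real.rpow_one]; field_simp
  -- the two cases
  have hc1 : ∀ i, ∀ x ∈ frontier Ω, x ∈ M i → w i ≤ ENNReal.ofReal k1 *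
      ∫⁻ y in frontier Ω, (A (i-1))ᶜ.indicator
        (fun y => ((‖x - y‖₊ : ℝ≥0∞) ^ ((n:ℝ) + σ))⁻¹) y ∂μH[(n:ℝ)] := by
    intro i x hx hxM
    simp only [hw]
    split_ifs with h0
    · by_cases ht : a (i-1) = ⊤
      · rw [ht, ENNReal.top_rpow_of_neg (by rw [neg_div]; simp; positivity)]; exact zero_le
      · obtain ⟨hr, hm⟩ := hmr i h0 ht
        have := case1_aux n hn σ hσ Ω hO hC x hx V hV _ (r i) hr hm (A (i-1)) (hAm _)
          (by rw [ENNReal.ofReal_toReal ht, ha]) hxM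
        rwa [ENNReal.ofReal_toReal ht] at this
    · exact zero_le
  have hc2 : ∀ i, ∀ x ∈ frontier Ω, x ∉ M i → w i ≤ ENNReal.ofReal k2 *
      (fracMeanCurv n α Ω x) ^ (σ/α) := by
    intro i x hx hxM
    simp only [hw]
    split_ifs with h0
    · by_cases ht : a (i-1) = ⊤
      · rw [ht, ENNReal.top_rpow_of_neg (by rw [neg_div]; simp; positivity)]; exact zero_le
      · obtain ⟨hr, hm⟩ := hmr i h0 ht
        have hvol : volume.real (Ω ∩ ball x (r i)) ≤ V * r i ^ (n+1) / 4 := by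
          simp only [hM, Set.mem_ofPred_eq, not_lt] at hxM
          exact ENNReal.toReal_le_of_le_ofReal (by positivity) hxM
        have := case2_aux n hn α σ hα0 hσ V hV _ (r i) hr hm _
          (curv_aux n hn α hα0 Ω hO hC x hx (r i) hr V hVdef hvol)
        rwa [ENNReal.ofReal_toReal ht] at this
    · exact zero_le
  set D := ∫⁻ x in frontier Ω, ∫⁻ y in frontier Ω,
                  (‖u x - u y‖₊ : ℝ≥0∞) ^ p / (‖x - y‖₊ : ℝ≥0∞) ^ ((n:ℝ) + σ)
                    ∂μH[(n:ℝ)] ∂μH[(n:ℝ)] with hD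
  set G := ∫⁻ x in frontier Ω,
                  (fracMeanCurv n α Ω x) ^ (σ/α) * (‖u x‖₊ : ℝ≥0∞) ^ p ∂μH[(n:ℝ)] with hG
  have hterm : ∀ i : ℤ, (if a (i-1) ≠ 0 then
                (2:ℝ≥0∞) ^ (p * i) * a (i-1) ^ (-σ/(n:ℝ)) * a i else 0)
      = (∫⁻ x in frontier Ω, (A i ∩ M i).indicator (fun _ => (2:ℝ≥0∞) ^ (p * i) * w i) x ∂μH[(n:ℝ)])
      + ∫⁻ x in frontier Ω, (A i \ M i).indicator (fun _ => (2:ℝ≥0∞) ^ (p * i) * w i) x ∂μH[(n:ℝ)] := by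
    intro i
    rw [lintegral_indicator_const ((hAm i).inter (hMm i)),
      lintegral_indicator_const ((hAm i).diff (hMm i)), ← mul_add,
      measure_inter_add_sdiff _ (hMm i), Measure.restrict_apply (hAm i),
      Set.inter_eq_left.2 (fun x hx => hx.1 : A i ⊆ frontier Ω), hw, ha i]
    simp only
    split_ifs <;> simp [hA]
  have hgeo : ∀ x, ∑' i : ℤ, (if (2:ℝ) ^ i < u x then (2:ℝ≥0∞) ^ (p * i) else 0)
      ≤ 2 * (‖u x‖₊ : ℝ≥0∞) ^ p := by
    intro x
    have := geo_aux p hp (u x) (hu0 x)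
    rwa [← Real.enorm_of_nonneg (hu0 x), enorm_eq_nnnorm] at this
  -- second part
  have hS2 : ∑' i : ℤ, ∫⁻ x in frontier Ω, (A i \ M i).indicator
      (fun _ => (2:ℝ≥0∞) ^ (p * i) * w i) x ∂μH[(n:ℝ)] ≤ ENNReal.ofReal (2 * k2) * G := by
    rw [← lintegral_tsum (fun i => (measurable_const.indicator ((hAm i).diff (hMm i))).aemeasurable),
      hG, ← lintegral_const_mul' _ _ ENNReal.ofReal_ne_top]
    refine setLIntegral_mono' hFm fun x hx => ?_
    calc ∑' i : ℤ, (A i \ M i).indicator (fun _ => (2:ℝ≥0∞) ^ (p * i) * w i) x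
        ≤ ∑' i : ℤ, (if (2:ℝ) ^ i < u x then (2:ℝ≥0∞) ^ (p * i) else 0) *
            (ENNReal.ofReal k2 * (fracMeanCurv n α Ω x) ^ (σ/α)) := by
          gcongr with i
          by_cases hxi : x ∈ A i \ M i
          · rw [Set.indicator_of_mem hxi, if_pos hxi.1.2]
            gcongr
            exact hc2 i x hx hxi.2
          · rw [Set.indicator_of_notMem hxi]; exact zero_le
      _ ≤ (2 * (‖u x‖₊ : ℝ≥0∞) ^ p) * (ENNReal.ofReal k2 * (fracMeanCurv n α Ω x) ^ (σ/α)) := by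
          rw [ENNReal.tsum_mul_right]
          gcongr
          exact hgeo x
      _ = _ := by
          rw [ENNReal.ofReal_mul (by norm_num : (0:ℝ) ≤ 2)]
          simp only [ENNReal.ofReal_ofNat]
          ring
  -- first part
  have hS1 : ∑' i : ℤ, ∫⁻ x in frontier Ω, (A i ∩ M i).indicator
      (fun _ => (2:ℝ≥0∞) ^ (p * i) * w i) x ∂μH[(n:ℝ)] ≤ ENNReal.ofReal (2 * 2 ^ p * k1) * D := by
    rw [← lintegral_tsum (fun i => (measurable_const.indicator ((hAm i).inter (hMm i))).aemeasurable),
      hD, ← lintegral_const_mul' _ _ ENNReal.ofReal_ne_top]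
    refine setLIntegral_mono' hFm fun x hx => ?_
    set κ : EuclideanSpace ℝ (Fin (n+1)) → ℝ≥0∞ :=
      fun y => ((‖x - y‖₊ : ℝ≥0∞) ^ ((n:ℝ) + σ))⁻¹ with hκ
    have hκm : Measurable κ := by rw [hκ]; fun_prop
    calc ∑' i : ℤ, (A i ∩ M i).indicator (fun _ => (2:ℝ≥0∞) ^ (p * i) * w i) x
        ≤ ∑' i : ℤ, ENNReal.ofReal k1 * ∫⁻ y in frontier Ω,
            (if (2:ℝ) ^ i < u x then (2:ℝ≥0∞) ^ (p * i) else 0) *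
            (A (i-1))ᶜ.indicator κ y ∂μH[(n:ℝ)] := by
          gcongr with i
          by_cases hxi : x ∈ A i ∩ M i
          · rw [Set.indicator_of_mem hxi, if_pos hxi.1.2,
              lintegral_const_mul _ (hκm.indicator (hAm _).compl), mul_left_comm]
            gcongr
            exact hc1 i x hx hxi.2
          · rw [Set.indicator_of_notMem hxi]; exact zero_le
      _ = ENNReal.ofReal k1 * ∫⁻ y in frontier Ω, ∑' i : ℤ,
            (if (2:ℝ) ^ i < u x then (2:ℝ≥0∞) ^ (p * i) else 0) *
            (A (i-1))ᶜ.indicator κ y ∂μH[(n:ℝ)] := by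
          rw [ENNReal.tsum_mul_left, lintegral_tsum]
          intro i
          exact ((hκm.indicator (hAm _).compl).const_mul _).aemeasurable
      _ ≤ ENNReal.ofReal k1 * ∫⁻ y in frontier Ω, ENNReal.ofReal (2 * 2 ^ p) *
            ((‖u x - u y‖₊ : ℝ≥0∞) ^ p / (‖x - y‖₊ : ℝ≥0∞) ^ ((n:ℝ) + σ)) ∂μH[(n:ℝ)] := by
          refine mul_le_mul_right ?_ _
          refine setLIntegral_mono' hFm fun y hy => ?_
          by_cases hxy : 2 * u y < u x
          · calc _ ≤ ∑' i : ℤ, (if (2:ℝ) ^ i < u x then (2:ℝ≥0∞) ^ (p * i) else 0) * κ y := by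
                  gcongr with i
                  exact Set.indicator_le_self _ _ _
              _ ≤ (2 * (‖u x‖₊ : ℝ≥0∞) ^ p) * κ y := by
                  rw [ENNReal.tsum_mul_right]
                  gcongr
                  exact hgeo x
              _ ≤ (2 * (2 * (‖u x - u y‖₊ : ℝ≥0∞)) ^ p) * κ y := by
                  gcongr
                  rw [← enorm_eq_nnnorm, ← enorm_eq_nnnorm, Real.enorm_of_nonneg (hu0 x),
                    Real.enorm_of_nonneg (by linarith [hu0 y])]
                  have : (2:ℝ≥0∞) = ENNReal.ofReal 2 := by simp
                  rw [this, ← ENNReal.ofReal_mul (by norm_num)]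
                  apply ENNReal.ofReal_le_ofReal
                  linarith
              _ = _ := by
                  rw [ENNReal.mul_rpow_of_nonneg _ _ (by linarith), hκ, div_eq_mul_inv,
                    ENNReal.ofReal_mul (by norm_num : (0:ℝ) ≤ 2), ← ENNReal.ofReal_rpow_of_pos (by norm_num)]
                  simp only [ENNReal.ofReal_ofNat]
                  ring
          · refine le_trans (le_of_eq ?_) zero_le
            rw [ENNReal.tsum_eq_zero]
            intro i
            by_cases h1 : (2:ℝ) ^ i < u x
            · have h2 : y ∈ A (i-1) := by
                refine ⟨hy, ?_⟩
                rw [zpow_sub_one₀ (by norm_num)]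
                linarith
              rw [Set.indicator_of_notMem (by simpa using h2), mul_zero]
            · rw [if_neg h1, zero_mul]
      _ = _ := by
          rw [lintegral_const_mul' _ _ ENNReal.ofReal_ne_top, ← mul_assoc,
            ← ENNReal.ofReal_mul hk1p.le, mul_comm k1]
  have hfin : ∑' i : ℤ, (if a (i-1) ≠ 0 then
                (2:ℝ≥0∞) ^ (p * i) * a (i-1) ^ (-σ/(n:ℝ)) * a i else 0)
      ≤ ENNReal.ofReal C * ((1/2) * D + G) := by
    simp_rw [hterm]
    rw [ENNReal.tsum_add, mul_add]
    refine add_le_add (hS1.trans ?_) (hS2.trans ?_)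
    · have : ENNReal.ofReal (2 * 2 ^ p * k1) = ENNReal.ofReal (4 * 2 ^ p * k1) * (1/2) := by
        have h2 : (1/2 : ℝ≥0∞) = ENNReal.ofReal (1/2) := by
          rw [ENNReal.ofReal_div_of_pos (by norm_num)]; simp
        rw [h2, ← ENNReal.ofReal_mul (by positivity)]; congr 1; ring
      rw [this, mul_assoc]
      gcongr
      rw [hCdef]; linarith
    · gcongr
      have : 0 < 4 * 2 ^ p * k1 := by positivity
      rw [hCdef]; linarith
  have hCne : ENNReal.ofReal C ≠ 0 := by simpa using hCp
  rw [ENNReal.coe_inv (by simpa using hCp)]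
  exact (ENNReal.inv_mul_le_iff hCne ENNReal.ofReal_ne_top).2 hfin
end

section
/- Let s, α ∈ (0,1) and p ≥ 1 with n > sp, and let Ω ⊂ ℝ^{n+1} be an open convex set. Let u ∈ L^∞(∂Ω, ℋ^n) be a non-negative function with compact support, and for i ∈ ℤ set a_i := ℋ^n({ x ∈ ∂Ω : u(x) > 2^i }). Then there is a constant c > 0 depending only on n, α, s, and p (in particular independent of Ω and u) such that (1/2) ∫_{∂Ω}∫_{∂Ω} |u(x)−u(y)|^p / |x−y|^{n+sp} dℋ^n(x)dℋ^n(y) + ∫_{∂Ω} H_α(x)^{sp/α} u(x)^p dℋ^n(x) ≥ c ∑_{i∈ℤ} 2^{pi} a_i^{(n−sp)/n}. -/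
open MeasureTheory Metric Filter
open scoped ENNReal NNReal Topology

lemma support_fun {n : ℕ} {Ω : Set (EuclideanSpace ℝ (Fin (n+1)))} (ho : IsOpen Ω)
    (hc : Convex ℝ Ω) {x : EuclideanSpace ℝ (Fin (n+1))} (hx : x ∉ Ω) :
    ∃ g : Fin (n+1) → ℝ, (∀ y ∈ Ω, 0 < ∑ j, g j * (x j - y j)) ∧ 
      ∃ i, ∀ j, |g j| ≤ |g i| := by
  obtain ⟨f, hf⟩ := geometric_hahn_banach_open_point hc ho hx
  have key : ∀ w : EuclideanSpace ℝ (Fin (n+1)), f w = ∑ j, f (EuclideanSpace.single j 1) * w j := by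
    intro w
    have h := (EuclideanSpace.basisFun (Fin (n+1)) ℝ).sum_repr w
    conv_lhs => rw [← h]
    simp [map_sum, mul_comm]
  refine ⟨fun j => f (EuclideanSpace.single j 1), ?_, ?_⟩
  · intro y hy
    have := hf y hy
    have h2 := key (x - y)
    simp only [PiLp.sub_apply] at h2
    rw [← h2, map_sub]; linarith
  · exact Finite.exists_max (fun j => |f (EuclideanSpace.single j 1)|)

/-- drop coordinate i -/
def drp {n : ℕ} (i : Fin (n+1)) (x : EuclideanSpace ℝ (Fin (n+1))) : Fin n → ℝ :=
  fun j => x (i.succAbove j)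

lemma drp_lip {n : ℕ} (i : Fin (n+1)) : LipschitzWith 1 (drp i) := by
  apply LipschitzWith.of_dist_le_mul
  intro x y
  rw [NNReal.coe_one, one_mul, dist_pi_le_iff dist_nonneg]
  intro j
  exact (PiLp.lipschitzWith_ofLp 2 (fun _ : Fin (n+1) => ℝ)).dist_le_mul x y |>.trans' (dist_le_pi_dist _ _ _) |>.trans (by simp)

lemma vol_cyl {n : ℕ} (i : Fin (n+1)) (I : Set ℝ) (S : Set (Fin n → ℝ)) :
    volume {y : EuclideanSpace ℝ (Fin (n+1)) | y i ∈ I ∧ drp i y ∈ S} = volume I * volume S := by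
  have h1 := (volume_preserving_piFinSuccAbove (fun _ : Fin (n+1) => ℝ) i).comp
    (PiLp.volume_preserving_ofLp (Fin (n+1)))
  have h2 := (volume_preserving_piFinSuccAbove (fun _ : Fin (n+1) => ℝ) i).measure_preimage_equiv (I ×ˢ S)
  have h3 := (EuclideanSpace.volume_preserving_symm_measurableEquiv_toLp (Fin (n+1))).measure_preimage_equiv 
    ((MeasurableEquiv.piFinSuccAbove (fun _ : Fin (n+1) => ℝ) i) ⁻¹' (I ×ˢ S))
  rw [h2, Measure.volume_eq_prod, Measure.prod_prod] at h3
  rw [← h3]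
  rfl

lemma vol_le {n : ℕ} {Ω : Set (EuclideanSpace ℝ (Fin (n+1)))} (ho : IsOpen Ω)
    (hc : Convex ℝ Ω) {x : EuclideanSpace ℝ (Fin (n+1))} (hx : x ∉ Ω) {r : ℝ} (hr : 0 < r) :
    volume (Ω ∩ ball x r) ≤
      ENNReal.ofReal (2 * r) * μH[(n:ℝ)] (frontier Ω ∩ ball x ((n+2) * r)) := by
  obtain ⟨g, hg, i, hi⟩ := support_fun ho hc hx
  set Γ := frontier Ω ∩ ball x ((n+2) * r)
  set σ : ℝ := ((SignType.sign (g i) : SignType) : ℝ) with hσ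
  have hσg : σ * g i = |g i| := sign_mul_self (g i)
  have hσ1 : |σ| ≤ 1 := by
    rcases lt_trichotomy (g i) 0 with h | h | h <;> simp [hσ, h]
  have h1 : Ω ∩ ball x r ⊆ {y | y i ∈ Set.Ioo (x i - r) (x i + r) ∧ drp i y ∈ drp i '' Γ} := by
    rintro y ⟨hyΩ, hyb⟩
    rw [mem_ball, dist_eq_norm] at hyb
    have hcoord : ∀ j, |y j - x j| < r := fun j =>
      lt_of_le_of_lt (by simpa using PiLp.norm_apply_le (y - x) j) hyb
    refine ⟨?_, ?_⟩
    · have := abs_lt.1 (hcoord i)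
      constructor <;> linarith
    · set z : EuclideanSpace ℝ (Fin (n+1)) := y + EuclideanSpace.single i ((n+1) * r * σ) with hz
      have hzΩ : z ∉ Ω := by
        intro hzΩ
        have h := hg z hzΩ
        have e : ∑ j, g j * (x j - z j) = ∑ j, g j * (x j - y j) - g i * ((n+1) * r * σ) := by
          rw [eq_sub_iff_add_eq]
          have : g i * ((n+1) * r * σ) = ∑ j, g j * (EuclideanSpace.single i ((n+1) * r * σ) : EuclideanSpace ℝ (Fin (n+1))) j := by
            simp
          rw [this, ← Finset.sum_add_distrib]
          refine Finset.sum_congr rfl fun j _ => ?_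
          simp only [hz, PiLp.add_apply]; ring
        have b : ∑ j, g j * (x j - y j) ≤ ∑ j : Fin (n+1), |g i| * r := by
          refine Finset.sum_le_sum fun j _ => ?_
          calc g j * (x j - y j) ≤ |g j * (x j - y j)| := le_abs_self _
            _ = |g j| * |y j - x j| := by rw [abs_mul, abs_sub_comm]
            _ ≤ _ := mul_le_mul (hi j) (hcoord j).le (abs_nonneg _) (abs_nonneg _)
        simp at b
        rw [e] at h
        have : g i * ((n+1) * r * σ) = (n+1) * (|g i| * r) := by rw [← hσg]; ring
        linarith
      have hpre := (convex_segment (𝕜 := ℝ) y z).isPreconnected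
      have : (segment ℝ y z ∩ frontier Ω).Nonempty := by
        by_contra hne
        rw [Set.not_nonempty_iff_eq_empty] at hne
        exact hzΩ (hpre.subset_of_closure_inter_subset ho ⟨y, left_mem_segment ℝ y z, hyΩ⟩ (by
          rintro w ⟨hw1, hw2⟩
          by_contra hw
          have : w ∈ segment ℝ y z ∩ frontier Ω := ⟨hw2, hw1, by rwa [ho.interior_eq]⟩
          rw [hne] at this; exact this) (right_mem_segment ℝ y z))
      obtain ⟨w, hws, hwf⟩ := this
      rw [segment_eq_image'] at hws
      obtain ⟨t, ⟨ht0, ht1⟩, rfl⟩ := hws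
      have hzy : z - y = EuclideanSpace.single i ((n+1) * r * σ) := by rw [hz]; abel
      rw [hzy] at hwf
      refine ⟨_, ⟨hwf, ?_⟩, ?_⟩
      · rw [mem_ball, dist_eq_norm]
        have hn : ‖t • (EuclideanSpace.single i ((n+1) * r * σ) : EuclideanSpace ℝ (Fin (n+1)))‖ ≤ (n+1) * r := by
          rw [norm_smul, PiLp.norm_single, Real.norm_eq_abs, Real.norm_eq_abs, abs_mul, abs_of_nonneg ht0,
            abs_of_nonneg (by positivity : (0:ℝ) ≤ (n+1) * r)]
          calc t * ((n+1) * r * |σ|) ≤ 1 * ((n+1) * r * 1) := by gcongr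
            _ = _ := by ring
        calc _ = ‖(y - x) + t • (EuclideanSpace.single i ((n+1) * r * σ) : EuclideanSpace ℝ (Fin (n+1)))‖ := by
              congr 1; simp only []; module
          _ ≤ _ := norm_add_le _ _
          _ < (n+2) * r := by linarith
      · funext j
        simp [drp, Fin.succAbove_ne]
  calc volume (Ω ∩ ball x r) ≤ _ := measure_mono h1
    _ = volume (Set.Ioo (x i - r) (x i + r)) * volume (drp i '' Γ) := vol_cyl i _ _
    _ ≤ _ := by
      have e1 : volume (Set.Ioo (x i - r) (x i + r)) = ENNReal.ofReal (2 * r) := by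
        rw [Real.volume_Ioo]; congr 1; ring
      have e2 := (drp_lip i).hausdorffMeasure_image_le (d := n) (by positivity) Γ
      have e3 : (μH[(n:ℝ)] : Measure (Fin n → ℝ)) = volume := by
        simpa using hausdorffMeasure_pi_real (ι := Fin n)
      rw [e1]
      gcongr
      simpa [e3] using e2

lemma fin_frontier {n : ℕ} {Ω : Set (EuclideanSpace ℝ (Fin (n+1)))} (ho : IsOpen Ω)
    (hc : Convex ℝ Ω) (x₀ : EuclideanSpace ℝ (Fin (n+1))) (R : ℝ) :
    μH[(n:ℝ)] (frontier Ω ∩ ball x₀ R) < ∞ := by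
  rcases Ω.eq_empty_or_nonempty with rfl | ⟨o, hoΩ⟩
  · simp
  let G : Fin (n+1) × Bool → Set (EuclideanSpace ℝ (Fin (n+1))) := fun iσ =>
    {x | x ∈ ball x₀ R ∧ ∃ g : Fin (n+1) → ℝ, (∀ y ∈ frontier Ω, 0 ≤ ∑ j, g j * (x j - y j)) ∧
      (∀ j, |g j| ≤ |g iσ.1|) ∧ (if iσ.2 then 0 < g iσ.1 else g iσ.1 < 0)}
  have hcov : frontier Ω ∩ ball x₀ R ⊆ ⋃ iσ, (frontier Ω ∩ G iσ) := by
    rintro x ⟨hxf, hxb⟩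
    have hx : x ∉ Ω := by
      have := hxf.2
      rwa [ho.interior_eq] at this
    obtain ⟨g, hg, i, hi⟩ := support_fun ho hc hx
    have hgi : g i ≠ 0 := by
      intro h0
      have : ∀ j, g j = 0 := fun j => by
        have := hi j
        rw [h0, abs_zero] at this
        exact abs_nonpos_iff.1 this
      have h := hg o hoΩ
      simp [this] at h
    have hcl : ∀ y ∈ frontier Ω, 0 ≤ ∑ j, g j * (x j - y j) := by
      intro y hy
      have hcl : IsClosed {y : EuclideanSpace ℝ (Fin (n+1)) | 0 ≤ ∑ j, g j * (x j - y j)} := by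
        apply isClosed_le continuous_const
        fun_prop
      exact closure_minimal (fun y hy => (hg y hy).le) hcl hy.1
    rw [Set.mem_iUnion]
    rcases lt_or_gt_of_ne hgi with h | h
    · exact ⟨(i, false), hxf, hxb, g, hcl, hi, by simpa using h⟩
    · exact ⟨(i, true), hxf, hxb, g, hcl, hi, by simpa using h⟩
  refine (measure_mono hcov).trans_lt ((measure_iUnion_le _).trans_lt ?_)
  rw [tsum_fintype, ENNReal.sum_lt_top]
  rintro ⟨i, σ⟩ -
  set Y := frontier Ω ∩ G (i, σ)
  -- graph estimate
  have hgr : ∀ x ∈ Y, ∀ y ∈ Y, |x i - y i| ≤ n * dist (drp i x) (drp i y) := by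
    have one : ∀ x ∈ Y, ∀ y ∈ Y, (if σ then (1:ℝ) else -1) * (y i - x i) ≤ n * dist (drp i x) (drp i y) := by
      rintro x ⟨-, -, g, hg, hgj, hgi⟩ y ⟨hyf, -⟩
      have h := hg y hyf
      rw [Fin.sum_univ_succAbove _ i] at h
      have b : ∑ j : Fin n, g (i.succAbove j) * (x (i.succAbove j) - y (i.succAbove j)) ≤
          ∑ j : Fin n, |g i| * dist (drp i x) (drp i y) := by
        refine Finset.sum_le_sum fun j _ => ?_
        refine (le_abs_self _).trans ?_
        rw [abs_mul]
        refine mul_le_mul (hgj _) ?_ (abs_nonneg _) (abs_nonneg _)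
        exact dist_le_pi_dist (drp i x) (drp i y) j
      simp only [Finset.sum_const, Finset.card_univ, Fintype.card_fin, nsmul_eq_mul] at b
      have hpos : 0 < |g i| := by
        cases σ <;> simp at hgi <;> simp <;> first | exact hgi.ne | exact hgi.ne'
      have : g i * (y i - x i) ≤ |g i| * (n * dist (drp i x) (drp i y)) := by linarith
      refine le_of_mul_le_mul_left ?_ hpos
      refine le_trans (le_of_eq ?_) this
      cases σ <;> simp at hgi <;> simp [abs_of_pos, abs_of_neg, hgi] <;> ring
    intro x hx y hy
    have h1 := one x hx y hy
    have h2 := one y hy x hx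
    rw [dist_comm] at h2
    rw [abs_le]
    cases σ <;> simp at h1 h2 <;> constructor <;> linarith
  have hdist : ∀ x ∈ Y, ∀ y ∈ Y, dist x y ≤ (n + 1) * (n + 1) * dist (drp i x) (drp i y) := by
    intro x hx y hy
    have hj : ∀ j, |x j - y j| ≤ (n + 1) * dist (drp i x) (drp i y) := by
      intro j
      rcases Fin.eq_self_or_eq_succAbove i j with rfl | ⟨k, rfl⟩
      · have := hgr x hx y hy
        have := @dist_nonneg _ _ (drp j x) (drp j y)
        linarith
      · have h1 : |x (i.succAbove k) - y (i.succAbove k)| ≤ dist (drp i x) (drp i y) := dist_le_pi_dist (drp i x) (drp i y) k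
        have : 0 ≤ n * dist (drp i x) (drp i y) := by positivity
        linarith
    have h1 : dist x y ≤ ∑ j, |x j - y j| := by
      rw [EuclideanSpace.dist_eq]
      refine Real.sqrt_le_iff.2 ⟨by positivity, ?_⟩
      simp only [Real.dist_eq]
      exact Finset.sum_sq_le_sq_sum_of_nonneg (fun j _ => abs_nonneg _)
    refine h1.trans ((Finset.sum_le_sum fun j _ => hj j).trans (le_of_eq ?_))
    simp; ring
  have hanti : AntilipschitzWith ((n+1)*(n+1) : ℝ≥0) (fun y : Y => drp i y.1) := by
    apply AntilipschitzWith.of_le_mul_dist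
    intro x y
    exact_mod_cast hdist x.1 x.2 y.1 y.2
  have h := hanti.le_hausdorffMeasure_image (d := n) (by positivity) Set.univ
  have h' : μH[(n:ℝ)] Y = μH[(n:ℝ)] (Set.univ : Set Y) := by
    rw [← (isometry_subtype_coe (s := Y)).hausdorffMeasure_image (Or.inl (by positivity))]
    simp
  rw [h']
  refine h.trans_lt (ENNReal.mul_lt_top (ENNReal.rpow_lt_top_of_nonneg (by positivity) ENNReal.coe_ne_top) ?_)
  have e3 : (μH[(n:ℝ)] : Measure (Fin n → ℝ)) = volume := by
    simpa using hausdorffMeasure_pi_real (ι := Fin n)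
  rw [e3]
  have hb : Bornology.IsBounded (drp i '' ball x₀ R) := (drp_lip i).isBounded_image isBounded_ball
  refine (hb.subset ?_).measure_lt_top
  rintro _ ⟨y, -, rfl⟩
  exact ⟨y.1, y.2.2.1, rfl⟩

lemma kern_int {n : ℕ} {α : ℝ} (hα : 0 < α) (x : EuclideanSpace ℝ (Fin (n+1))) {ε : ℝ} (hε : 0 < ε) :
    IntegrableOn (fun y => ‖y - x‖ ^ (-((n:ℝ) + 1 + α))) (ball x ε)ᶜ := by
  have h1 : Integrable (fun y : EuclideanSpace ℝ (Fin (n+1)) => (1 + ‖y‖) ^ (-((n:ℝ) + 1 + α))) :=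
    integrable_one_add_norm (by simp; linarith)
  have h2 := (h1.comp_sub_right x).const_mul ((ε/(1+ε)) ^ (-((n:ℝ) + 1 + α)))
  refine (h2.integrableOn (s := (ball x ε)ᶜ)).mono' ?_ ?_
  · exact (Measurable.pow_const (by fun_prop) _).aestronglyMeasurable
  · refine (ae_restrict_iff' measurableSet_ball.compl).2 (Eventually.of_forall fun y hy => ?_)
    have hy' : ε ≤ ‖y - x‖ := by
      simpa [dist_eq_norm] using hy
    rw [Real.norm_of_nonneg (by positivity), ← Real.mul_rpow (by positivity) (by positivity)]
    apply Real.rpow_le_rpow_of_nonpos (by positivity)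
    · rw [div_mul_eq_mul_div, div_le_iff₀ (by positivity)]
      nlinarith
    · have : (0:ℝ) ≤ n := by positivity
      linarith

lemma curv_le {n : ℕ} {α : ℝ} (hα : 0 < α) {Ω : Set (EuclideanSpace ℝ (Fin (n+1)))} (ho : IsOpen Ω)
    (hc : Convex ℝ Ω) {x : EuclideanSpace ℝ (Fin (n+1))} (hx : x ∉ Ω) {r : ℝ} (hr : 0 < r)
    (hv : volume.real (Ω ∩ ball x r) ≤ volume.real (ball x r) / 8) :
    ENNReal.ofReal (α / 8 * volume.real (ball (0 : EuclideanSpace ℝ (Fin (n+1))) 1) * r ^ (-α)) ≤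
      fracMeanCurv n α Ω x := by
  unfold fracMeanCurv
  refine le_limsup_of_frequently_le (Eventually.frequently ?_)
  filter_upwards [Ioo_mem_nhdsGT (show (0:ℝ) < r / 2 by positivity)] with ε hε
  obtain ⟨hε0, hεr⟩ := hε
  apply ENNReal.ofReal_le_ofReal
  set β := (n:ℝ) + 1 + α with hβ
  set ω := volume.real (ball (0 : EuclideanSpace ℝ (Fin (n+1))) 1)
  have hball : ∀ t : ℝ, 0 < t → volume.real (ball x t) = t ^ (n+1) * ω := by
    intro t ht
    have := Measure.addHaar_ball_of_pos (volume : Measure (EuclideanSpace ℝ (Fin (n+1)))) x ht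
    rw [measureReal_def, this, ENNReal.toReal_mul, ENNReal.toReal_ofReal (by positivity)]
    simp [ω, measureReal_def]
  set f : EuclideanSpace ℝ (Fin (n+1)) → ℝ := fun y => (Set.indicator Ωᶜ (fun _ => (1:ℝ)) y - Set.indicator Ω (fun _ => (1:ℝ)) y)
          * ‖y - x‖ ^ (-β) with hf
  set h := (ball x ε)ᶜ.indicator f with hh
  have hsgn : ∀ y, |Set.indicator Ωᶜ (fun _ => (1:ℝ)) y - Set.indicator Ω (fun _ => (1:ℝ)) y| ≤ 1 := by
    intro y
    by_cases hy : y ∈ Ω <;> simp [hy]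
  have hint : Integrable h := by
    rw [hh, integrable_indicator_iff measurableSet_ball.compl]
    refine Integrable.mono (kern_int hα x hε0) ?_ (Eventually.of_forall fun y => ?_)
    · refine Measurable.aestronglyMeasurable ?_
      refine Measurable.mul ?_ (Measurable.pow_const (by fun_prop) _)
      exact (measurable_const.indicator ho.measurableSet.compl).sub
        (measurable_const.indicator ho.measurableSet)
    · rw [hf, norm_mul]
      exact mul_le_of_le_one_left (norm_nonneg _) (hsgn y)
  have hI : ∫ y in (ball x ε)ᶜ, f y = ∫ y, h y := (integral_indicator measurableSet_ball.compl).symm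
  rw [hI]
  have hrefl : ∫ y, h (x + x - y) = ∫ y, h y := integral_sub_left_eq_self h volume (x + x)
  have hint2 : Integrable (fun y => h (x + x - y)) := hint.comp_sub_left (x+x)
  have hsum : ∫ y, (h y + h (x + x - y)) = 2 * ∫ y, h y := by
    rw [integral_add hint hint2, hrefl]; ring
  have hnorm : ∀ y, ‖x + x - y - x‖ = ‖y - x‖ := by
    intro y; rw [← norm_neg]; congr 1; abel
  have hmem : ∀ y t, x + x - y ∈ ball x t ↔ y ∈ ball x t := by
    intro y t; rw [mem_ball, mem_ball, dist_eq_norm, dist_eq_norm, hnorm]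
  have hnot : ∀ y, y ∈ Ω → x + x - y ∉ Ω := by
    intro y hy hy'
    apply hx
    have := hc hy hy' (a := 1/2) (b := 1/2) (by norm_num) (by norm_num) (by norm_num)
    convert this using 1
    rw [← smul_add, add_sub_cancel, ← two_smul ℝ x, smul_smul]; norm_num
  set W := (ball x r \ ball x ε) \ (Ω ∪ (fun y => x + x - y) ⁻¹' Ω) with hW
  have hmp := Measure.measurePreserving_sub_left (volume : Measure (EuclideanSpace ℝ (Fin (n+1)))) (x + x)
  have hWm : MeasurableSet W :=
    (measurableSet_ball.diff measurableSet_ball).diff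
      (ho.measurableSet.union (hmp.measurable ho.measurableSet))
  have hpt : ∀ y, W.indicator (fun _ => 2 * r ^ (-β)) y ≤ h y + h (x + x - y) := by
    intro y
    by_cases hyε : y ∈ ball x ε
    · have : y ∉ W := fun h => h.1.2 hyε
      rw [Set.indicator_of_notMem this, hh, Set.indicator_of_notMem (by simpa using hyε),
        Set.indicator_of_notMem (by simpa [hmem] using hyε), add_zero]
    · have g1 : h y = f y := Set.indicator_of_mem (show y ∈ (ball x ε)ᶜ from hyε) _
      have g2 : h (x + x - y) = f (x + x - y) := Set.indicator_of_mem
        (show x + x - y ∈ (ball x ε)ᶜ from fun hc' => hyε ((hmem y ε).1 hc')) _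
      rw [g1, g2]
      simp only [hf, hnorm]
      have hk : 0 ≤ ‖y - x‖ ^ (-β) := by positivity
      by_cases hyW : y ∈ W
      · have h1 : y ∉ Ω := fun h => hyW.2 (Or.inl h)
        have h2 : x + x - y ∉ Ω := fun h => hyW.2 (Or.inr h)
        have h3 : r ^ (-β) ≤ ‖y - x‖ ^ (-β) := by
          have a1 : ‖y - x‖ < r := by simpa [dist_eq_norm] using hyW.1.1
          have a2 : ε ≤ ‖y - x‖ := by simpa [dist_eq_norm] using hyε
          apply Real.rpow_le_rpow_of_nonpos (by linarith) a1.le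
          have : (0:ℝ) ≤ n := by positivity
          linarith
        simp [hyW, h1, h2]; linarith
      · rw [Set.indicator_of_notMem hyW]
        by_cases h1 : y ∈ Ω
        · have h2 := hnot y h1
          simp [h1, h2]
        · by_cases h2 : x + x - y ∈ Ω
          · simp [h1, h2]
          · simp [h1, h2]; exact hk
  have hWfin : volume W ≠ ∞ := (measure_mono (fun y hy => hy.1.1 : W ⊆ ball x r)).trans_lt measure_ball_lt_top |>.ne
  have hlow : volume.real W * (2 * r ^ (-β)) ≤ 2 * ∫ y, h y := by
    rw [← hsum]
    have e : ∫ y, W.indicator (fun _ => 2 * r ^ (-β)) y = volume.real W * (2 * r ^ (-β)) := by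
      rw [integral_indicator hWm, setIntegral_const, smul_eq_mul]
    rw [← e]
    exact integral_mono ((integrable_indicator_iff hWm).2 (integrableOn_const hWfin)) (hint.add hint2) hpt
  have hcover : ball x r ⊆ W ∪ (ball x ε ∪ ((Ω ∩ ball x r) ∪ (fun y => x + x - y) ⁻¹' (Ω ∩ ball x r))) := by
    intro y hy
    by_cases h1 : y ∈ ball x ε
    · exact Or.inr (Or.inl h1)
    by_cases h2 : y ∈ Ω
    · exact Or.inr (Or.inr (Or.inl ⟨h2, hy⟩))
    by_cases h3 : x + x - y ∈ Ω
    · exact Or.inr (Or.inr (Or.inr ⟨h3, (hmem y r).2 hy⟩))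
    · exact Or.inl ⟨⟨hy, h1⟩, fun h => h.elim h2 h3⟩
  have hfin1 : volume (Ω ∩ ball x r) ≠ ∞ := ((measure_mono Set.inter_subset_right).trans_lt measure_ball_lt_top).ne
  have hpre : volume ((fun y => x + x - y) ⁻¹' (Ω ∩ ball x r)) = volume (Ω ∩ ball x r) :=
    hmp.measure_preimage (ho.measurableSet.inter measurableSet_ball).nullMeasurableSet
  have hpre' : volume.real ((fun y => x + x - y) ⁻¹' (Ω ∩ ball x r)) = volume.real (Ω ∩ ball x r) := by
    rw [measureReal_def, hpre, measureReal_def]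
  have hVW : volume.real (ball x r) / 4 ≤ volume.real W := by
    have a1 : volume.real (ball x r) ≤ volume.real W + (volume.real (ball x ε) + (volume.real (Ω ∩ ball x r) + volume.real (Ω ∩ ball x r))) := by
      refine (measureReal_mono hcover ?_).trans ?_
      · refine (measure_union_lt_top hWfin.lt_top (measure_union_lt_top measure_ball_lt_top (measure_union_lt_top hfin1.lt_top ?_))).ne
        rw [hpre]; exact hfin1.lt_top
      · refine (measureReal_union_le _ _).trans ?_
        gcongr
        refine (measureReal_union_le _ _).trans ?_
        gcongr
        refine (measureReal_union_le _ _).trans ?_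
        rw [hpre']
    have a2 : volume.real (ball x ε) ≤ volume.real (ball x r) / 2 := by
      rw [hball ε hε0, hball r hr]
      have hω : 0 ≤ ω := measureReal_nonneg
      have : ε ^ (n+1) ≤ r ^ (n+1) / 2 := by
        calc ε ^ (n+1) ≤ (r/2) ^ (n+1) := by gcongr
          _ = r ^ (n+1) / 2 ^ (n+1) := div_pow _ _ _
          _ ≤ r ^ (n+1) / 2 := by
            gcongr
            calc (2:ℝ) = 2 ^ 1 := by norm_num
              _ ≤ 2 ^ (n+1) := pow_le_pow_right₀ (by norm_num) (by omega)
      nlinarith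
    linarith
  have hrr : r ^ (n+1) * r ^ (-β) = r ^ (-α) := by
    rw [← Real.rpow_natCast, ← Real.rpow_add hr]
    congr 1; rw [hβ]; push_cast; ring
  have hrβ : 0 ≤ r ^ (-β) := by positivity
  rw [hball r hr] at hVW
  have hfinal : ω * r ^ (-α) / 4 ≤ ∫ y, h y := by
    rw [← hrr]
    nlinarith [mul_le_mul_of_nonneg_right hVW hrβ]
  nlinarith

lemma key_r (n : ℕ) (α q : ℝ) (hα : 0 < α) (hq : 0 < q) :
    ∃ c κ : ℝ, 0 < c ∧ 0 < κ ∧ ∀ (Ω : Set (EuclideanSpace ℝ (Fin (n+1)))), IsOpen Ω → Convex ℝ Ω →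
      ∀ x ∈ frontier Ω, ∀ E : Set (EuclideanSpace ℝ (Fin (n+1))), MeasurableSet E → ∀ r : ℝ, 0 < r →
      μH[(n:ℝ)] E ≤ ENNReal.ofReal (κ * r ^ n) →
      ENNReal.ofReal (c * r ^ (-q)) ≤ (fracMeanCurv n α Ω x) ^ (q/α) +
        ∫⁻ y in frontier Ω \ E, ((‖x - y‖₊ : ℝ≥0∞) ^ ((n:ℝ) + q))⁻¹ ∂μH[(n:ℝ)] := by
  set ω := volume.real (ball (0 : EuclideanSpace ℝ (Fin (n+1))) 1) with hω
  have hωpos : 0 < ω := by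
    rw [hω, measureReal_def]
    exact ENNReal.toReal_pos (measure_ball_pos _ _ one_pos).ne' measure_ball_lt_top.ne
  set κ := ω / 32 with hκ
  have hκpos : 0 < κ := by positivity
  set c1 := κ * ((n:ℝ)+2) ^ (-((n:ℝ) + q)) with hc1
  set c2 := (α / 8 * ω) ^ (q/α) with hc2
  refine ⟨min c1 c2, κ, lt_min (by positivity) (by positivity), hκpos, ?_⟩
  intro Ω ho hc x hxf E hE r hr hμE
  have hx : x ∉ Ω := by
    have := hxf.2
    rwa [ho.interior_eq] at this
  set Γ := frontier Ω ∩ ball x ((n+2) * r) with hΓ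
  have hΓm : MeasurableSet Γ := isClosed_frontier.measurableSet.inter measurableSet_ball
  rcases le_or_gt (ENNReal.ofReal (2 * (κ * r ^ n))) (μH[(n:ℝ)] Γ) with h | h
  · refine le_trans ?_ le_add_self
    have h1 : ENNReal.ofReal (κ * r ^ n) ≤ μH[(n:ℝ)] (Γ \ E) := by
      have h2 : μH[(n:ℝ)] Γ ≤ μH[(n:ℝ)] (Γ \ E) + μH[(n:ℝ)] E := by
        refine (measure_mono ?_).trans (measure_union_le _ _)
        intro y hy
        by_cases hyE : y ∈ E
        · exact Or.inr hyE
        · exact Or.inl ⟨hy, hyE⟩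
      have h3 := h.trans (h2.trans (add_le_add_right hμE _))
      rw [two_mul, ENNReal.ofReal_add (by positivity) (by positivity)] at h3
      exact (ENNReal.add_le_add_iff_right ENNReal.ofReal_ne_top).1 h3
    calc ENNReal.ofReal (min c1 c2 * r ^ (-q)) 
        ≤ ENNReal.ofReal ((((n:ℝ)+2) * r) ^ (-((n:ℝ)+q))) * ENNReal.ofReal (κ * r ^ n) := by
          rw [← ENNReal.ofReal_mul (by positivity)]
          apply ENNReal.ofReal_le_ofReal
          have e : (((n:ℝ)+2) * r) ^ (-((n:ℝ)+q)) * (κ * r ^ n) = c1 * r ^ (-q) := by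
            rw [Real.mul_rpow (by positivity) hr.le, ← Real.rpow_natCast r n, hc1,
              show -((n:ℝ) + q) = -q + -n by ring, Real.rpow_add hr, Real.rpow_neg hr.le (n:ℝ)]
            have : r ^ (n:ℝ) ≠ 0 := by positivity
            field_simp
          rw [e]
          gcongr
          exact min_le_left _ _
      _ ≤ ENNReal.ofReal ((((n:ℝ)+2) * r) ^ (-((n:ℝ)+q))) * μH[(n:ℝ)] (Γ \ E) := by gcongr
      _ = ∫⁻ y in Γ \ E, ENNReal.ofReal ((((n:ℝ)+2) * r) ^ (-((n:ℝ)+q))) ∂μH[(n:ℝ)] := by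
          rw [setLIntegral_const]
      _ ≤ ∫⁻ y in Γ \ E, ((‖x - y‖₊ : ℝ≥0∞) ^ ((n:ℝ) + q))⁻¹ ∂μH[(n:ℝ)] := by
          refine setLIntegral_mono' (hΓm.diff hE) fun y hy => ?_
          have hy1 : ‖x - y‖ < (n+2) * r := by
            have := hy.1.2
            rwa [mem_ball, dist_comm, dist_eq_norm] at this
          rw [Real.rpow_neg (by positivity), ENNReal.ofReal_inv_of_pos (by positivity)]
          apply ENNReal.inv_le_inv.2
          rw [← ENNReal.ofReal_rpow_of_nonneg (by positivity) (by positivity)]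
          apply ENNReal.rpow_le_rpow _ (by positivity)
          rw [← enorm_eq_nnnorm, ← ofReal_norm]
          exact ENNReal.ofReal_le_ofReal hy1.le
      _ ≤ _ := lintegral_mono_set (Set.sdiff_subset_sdiff_left Set.inter_subset_left)
  · refine le_trans ?_ le_self_add
    have hv := vol_le ho hc hx hr
    have hball : volume.real (ball x r) = r ^ (n+1) * ω := by
      have := Measure.addHaar_ball_of_pos (volume : Measure (EuclideanSpace ℝ (Fin (n+1)))) x hr
      rw [measureReal_def, this, ENNReal.toReal_mul, ENNReal.toReal_ofReal (by positivity)]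
      simp [ω, measureReal_def]
    have hv2 : volume.real (Ω ∩ ball x r) ≤ volume.real (ball x r) / 8 := by
      rw [measureReal_def]
      refine ENNReal.toReal_le_of_le_ofReal (by positivity) (hv.trans ?_)
      refine (mul_le_mul_right h.le _).trans ?_
      rw [← ENNReal.ofReal_mul (by positivity)]
      apply ENNReal.ofReal_le_ofReal
      rw [hball, hκ, pow_succ]
      apply le_of_eq; ring
    have hH := curv_le hα ho hc hx hr hv2
    refine le_trans ?_ (ENNReal.rpow_le_rpow hH (by positivity : 0 ≤ q / α))
    rw [ENNReal.ofReal_rpow_of_nonneg (by positivity) (by positivity)]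
    apply ENNReal.ofReal_le_ofReal
    rw [Real.mul_rpow (by positivity) (by positivity), ← Real.rpow_mul hr.le,
      show -α * (q / α) = -q by field_simp]
    gcongr
    exact min_le_right _ _

lemma key_a (n : ℕ) (hn : 1 ≤ n) (α q : ℝ) (hα : 0 < α) (hq : 0 < q) :
    ∃ c : ℝ≥0, 0 < c ∧ ∀ (Ω : Set (EuclideanSpace ℝ (Fin (n+1)))), IsOpen Ω → Convex ℝ Ω →
      ∀ x ∈ frontier Ω, ∀ E : Set (EuclideanSpace ℝ (Fin (n+1))), MeasurableSet E → 
      c * (μH[(n:ℝ)] E) ^ (-(q/n)) ≤ (fracMeanCurv n α Ω x) ^ (q/α) +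
        ∫⁻ y in frontier Ω \ E, ((‖x - y‖₊ : ℝ≥0∞) ^ ((n:ℝ) + q))⁻¹ ∂μH[(n:ℝ)] := by
  obtain ⟨c, κ, hc, hκ, H⟩ := key_r n α q hα hq
  have hn' : (0:ℝ) < n := by exact_mod_cast hn
  have hd : 0 < c * κ ^ (q/n) := by positivity
  refine ⟨(c * κ ^ (q/n)).toNNReal, Real.toNNReal_pos.2 hd, ?_⟩
  intro Ω ho hcv x hx E hE
  set X := (fracMeanCurv n α Ω x) ^ (q/α) +
        ∫⁻ y in frontier Ω \ E, ((‖x - y‖₊ : ℝ≥0∞) ^ ((n:ℝ) + q))⁻¹ ∂μH[(n:ℝ)]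
  have H2 : ∀ m : ℝ, 0 < m → μH[(n:ℝ)] E ≤ ENNReal.ofReal m →
      ENNReal.ofReal (c * κ ^ (q/n) * m ^ (-(q/n))) ≤ X := by
    intro m hm hE'
    have h := H Ω ho hcv x hx E hE ((m/κ) ^ (1/(n:ℝ))) (by positivity) (by
      rw [← Real.rpow_natCast, ← Real.rpow_mul (by positivity), one_div_mul_cancel hn'.ne', Real.rpow_one,
        mul_div_cancel₀ _ hκ.ne']
      exact hE')
    refine le_trans (ENNReal.ofReal_le_ofReal (le_of_eq ?_)) h
    rw [← Real.rpow_mul (by positivity), show 1/(n:ℝ) * -q = -(q/n) by ring,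
      Real.div_rpow hm.le hκ.le, Real.rpow_neg hκ.le (q/n)]
    field_simp
  have hco : (((c * κ ^ (q/n)).toNNReal : ℝ≥0) : ℝ≥0∞) = ENNReal.ofReal (c * κ ^ (q/n)) := rfl
  rw [hco]
  rcases eq_or_ne (μH[(n:ℝ)] E) ∞ with h | h
  · rw [h, ENNReal.top_rpow_of_neg (by have : 0 < q / n := by positivity
                                       linarith)]
    simp
  rcases eq_or_ne (μH[(n:ℝ)] E) 0 with h0 | h0
  · have : X = ∞ := by
      apply ENNReal.eq_top_of_forall_nnreal_le
      intro M
      have hM : (0:ℝ) < (M + 1) / (c * κ ^ (q/n)) := by positivity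
      have := H2 (((M + 1) / (c * κ ^ (q/n))) ^ (-(n/q))) (by positivity) (by rw [h0]; exact zero_le)
      rw [← Real.rpow_mul hM.le, show -((n:ℝ)/q) * -(q/n) = 1 by field_simp, Real.rpow_one,
        mul_div_cancel₀ _ hd.ne'] at this
      refine le_trans ?_ this
      rw [← ENNReal.ofReal_coe_nnreal]
      exact ENNReal.ofReal_le_ofReal (by linarith)
    rw [this]; exact le_top
  · have hp : 0 < (μH[(n:ℝ)] E).toReal := ENNReal.toReal_pos h0 h
    have := H2 _ hp (by rw [ENNReal.ofReal_toReal h])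
    rwa [ENNReal.ofReal_mul hd.le, ← ENNReal.ofReal_rpow_of_pos hp, ENNReal.ofReal_toReal h] at this

lemma geo_sum (f : ℤ → ℝ≥0∞) (L : ℤ) (M : ℝ≥0∞) (h0 : ∀ k, L < k → f k = 0)
    (h : ∀ m : ℕ, f (L - m) ≤ M * 2⁻¹ ^ m) : ∑' k, f k ≤ 2 * M := by
  have hinj : Function.Injective (fun m : ℕ => L - (m:ℤ)) := fun a b hab => by
    simp only at hab; omega
  rw [← hinj.tsum_eq (f := f) ?_]
  · refine (ENNReal.tsum_le_tsum h).trans ?_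
    rw [ENNReal.tsum_mul_left, ENNReal.tsum_geometric, ENNReal.one_sub_inv_two, inv_inv, mul_comm]
  · intro k hk
    have : k ≤ L := by
      by_contra hh
      exact hk (h0 k (by omega))
    exact ⟨(L - k).toNat, by simp; omega⟩

lemma two_geo {p : ℝ} (hp : 1 ≤ p) (L : ℤ) (m : ℕ) :
    (2:ℝ≥0∞) ^ (p * ((L - m : ℤ) : ℝ)) ≤ 2 ^ (p * (L:ℝ)) * 2⁻¹ ^ m := by
  have : (2⁻¹ : ℝ≥0∞) ^ m = 2 ^ (-(m:ℝ)) := by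
    rw [ENNReal.rpow_neg, ENNReal.rpow_natCast, ENNReal.inv_pow]
  rw [this, ← ENNReal.rpow_add _ _ (by norm_num) (by norm_num)]
  apply ENNReal.rpow_le_rpow_of_exponent_le (by norm_num)
  push_cast
  have : (0:ℝ) ≤ m := by positivity
  nlinarith

lemma seq_le (p θ : ℝ) (h0 : 0 < θ) (h1 : θ < 1) :
    ∃ C : ℝ≥0, 0 < C ∧ ∀ a : ℤ → ℝ≥0∞, (∀ k, a (k+1) ≤ a k) → (∀ k, a k ≠ ∞) →
      ∑' k : ℤ, (2:ℝ≥0∞) ^ (p * (k:ℝ)) * a k ^ (1 - θ) ≠ ∞ →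
      ∑' k : ℤ, (2:ℝ≥0∞) ^ (p * (k:ℝ)) * a k ^ (1 - θ) ≤
        C * ∑' k : ℤ, (2:ℝ≥0∞) ^ (p * (k:ℝ)) * (a k ^ (-θ) * a (k+1)) := by
  -- the small ratio
  set ν : ℝ := (2 ^ (-(p+1))) ^ (1/(1-θ)) with hν
  have hνpos : 0 < ν := by positivity
  have h1' : 0 < 1 - θ := by linarith
  have hν1 : ν ^ (1-θ) = 2 ^ (-(p+1)) := by
    rw [hν, ← Real.rpow_mul (by positivity), one_div_mul_cancel h1'.ne', Real.rpow_one]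
  set μ : ℝ≥0∞ := ENNReal.ofReal ν with hμ
  have hμ1 : (2:ℝ≥0∞) ^ p * μ ^ (1-θ) = 2⁻¹ := by
    rw [hμ, ENNReal.ofReal_rpow_of_pos hνpos, hν1, ← ENNReal.ofReal_rpow_of_pos (by norm_num)]
    simp only [ENNReal.ofReal_ofNat]
    rw [← ENNReal.rpow_add _ _ (by norm_num) (by norm_num), show p + -(p+1) = -1 by ring, ENNReal.rpow_neg_one]
  set D : ℝ≥0∞ := (2:ℝ≥0∞) ^ p * μ ^ (-θ) with hD
  have hμ0 : μ ≠ 0 := by simp [hμ, hνpos]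
  have hμt : μ ≠ ∞ := ENNReal.ofReal_ne_top
  have hDt : D ≠ ∞ := ENNReal.mul_ne_top (ENNReal.rpow_ne_top_of_ne_zero (by norm_num) (by norm_num))
    (ENNReal.rpow_ne_top_of_ne_zero hμ0 hμt)
  have hD0 : D ≠ 0 := mul_ne_zero (ENNReal.rpow_pos (by norm_num) (by norm_num)).ne'
    (ENNReal.rpow_pos hμ0.bot_lt hμt).ne'
  have hcoe : ((2 * D.toNNReal : ℝ≥0) : ℝ≥0∞) = 2 * D := by
    push_cast; rw [ENNReal.coe_toNNReal hDt]
  refine ⟨2 * D.toNNReal, mul_pos (by norm_num) (ENNReal.toNNReal_pos hD0 hDt), ?_⟩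
  intro a ha hat hS
  rw [hcoe]
  set S := ∑' k : ℤ, (2:ℝ≥0∞) ^ (p * (k:ℝ)) * a k ^ (1 - θ) with hSdef
  set T := ∑' k : ℤ, (2:ℝ≥0∞) ^ (p * (k:ℝ)) * (a k ^ (-θ) * a (k+1)) with hT
  have hterm : ∀ k : ℤ, (2:ℝ≥0∞) ^ (p * ((k+1 : ℤ):ℝ)) * a (k+1) ^ (1 - θ) ≤
      D * ((2:ℝ≥0∞) ^ (p * (k:ℝ)) * (a k ^ (-θ) * a (k+1))) + 2⁻¹ * ((2:ℝ≥0∞) ^ (p * (k:ℝ)) * a k ^ (1 - θ)) := by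
    intro k
    have e2 : (2:ℝ≥0∞) ^ (p * ((k+1 : ℤ):ℝ)) = 2 ^ p * 2 ^ (p * (k:ℝ)) := by
      rw [← ENNReal.rpow_add _ _ (by norm_num) (by norm_num)]; congr 1; push_cast; ring
    rw [e2]
    rcases le_or_gt (μ * a k) (a (k+1)) with h | h
    · refine le_trans ?_ le_self_add
      rcases eq_or_ne (a (k+1)) 0 with hz | hz
      · rw [hz, ENNReal.zero_rpow_of_pos h1']; simp
      have hak : a k ≠ 0 := fun h' => hz (le_antisymm (h' ▸ ha k) zero_le)
      have : a (k+1) ^ (1-θ) ≤ μ ^ (-θ) * (a k ^ (-θ) * a (k+1)) := by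
        rw [show 1 - θ = -θ + 1 by ring, ENNReal.rpow_add _ _ hz (hat _), ENNReal.rpow_one, ← mul_assoc]
        gcongr
        rw [← ENNReal.mul_rpow_of_ne_top hμt (hat k), ENNReal.rpow_neg, ENNReal.rpow_neg]
        exact ENNReal.inv_le_inv.2 (ENNReal.rpow_le_rpow h h0.le)
      calc _ ≤ 2 ^ p * 2 ^ (p * (k:ℝ)) * (μ ^ (-θ) * (a k ^ (-θ) * a (k+1))) := by gcongr
        _ = _ := by rw [hD]; ring
    · refine le_trans ?_ le_add_self
      calc _ ≤ 2 ^ p * 2 ^ (p * (k:ℝ)) * (μ * a k) ^ (1-θ) := by gcongr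
        _ = _ := by rw [ENNReal.mul_rpow_of_nonneg _ _ h1'.le, ← hμ1]; ring
  have hSle : S ≤ D * T + 2⁻¹ * S := by
    calc S = ∑' k : ℤ, (2:ℝ≥0∞) ^ (p * ((k+1 : ℤ):ℝ)) * a (k+1) ^ (1 - θ) :=
          ((Equiv.addRight (1:ℤ)).tsum_eq (fun k : ℤ => (2:ℝ≥0∞) ^ (p * (k:ℝ)) * a k ^ (1 - θ))).symm
      _ ≤ _ := ENNReal.tsum_le_tsum hterm
      _ = _ := by rw [ENNReal.tsum_add, ENNReal.tsum_mul_left, ENNReal.tsum_mul_left]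
  have hhalf : S = 2⁻¹ * S + 2⁻¹ * S := by
    rw [← add_mul, ENNReal.inv_two_add_inv_two, one_mul]
  have h2 : 2⁻¹ * S ≤ D * T := by
    have hfin : 2⁻¹ * S ≠ ∞ := ENNReal.mul_ne_top (by norm_num) hS
    rw [hhalf] at hSle
    rw [← hhalf] at hSle
    nth_rewrite 1 [hhalf] at hSle
    exact (ENNReal.add_le_add_iff_right hfin).1 hSle
  calc S = 2 * (2⁻¹ * S) := by rw [← mul_assoc, ENNReal.mul_inv_cancel (by norm_num) (by norm_num), one_mul]
    _ ≤ 2 * (D * T) := by gcongr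
    _ = _ := by ring

lemma two_eq (p : ℝ) (i : ℤ) : (2:ℝ≥0∞) ^ (p * (i:ℝ)) = (ENNReal.ofReal ((2:ℝ) ^ i)) ^ p := by
  have : ENNReal.ofReal ((2:ℝ) ^ i) = (2:ℝ≥0∞) ^ (i:ℝ) := by
    rw [← Real.rpow_intCast, ← ENNReal.ofReal_rpow_of_pos (by norm_num)]; simp
  rw [this, ← ENNReal.rpow_mul, mul_comm]

/-- Lower bound of the fractional energy on a convex hypersurface by the series
`∑_{i∈ℤ} 2^{pi} a_i^{(n-sp)/n}` of the level-set measures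
`a_i = ℋ^n({u > 2^i})`, with a universal constant. -/
theorem energy_lower_bound_levels_sobolev
    (n : ℕ) (hn : 1 ≤ n) (α s p : ℝ)
    (hα : α ∈ Set.Ioo (0:ℝ) 1) (hs : s ∈ Set.Ioo (0:ℝ) 1)
    (hp : 1 ≤ p) (hsp : s * p < n) :
    ∃ c : ℝ≥0, 0 < c ∧
      ∀ (Ω : Set (EuclideanSpace ℝ (Fin (n+1)))), IsOpen Ω → Convex ℝ Ω →
      ∀ u : EuclideanSpace ℝ (Fin (n+1)) → ℝ,
        Measurable u → (∀ x, 0 ≤ u x) → HasCompactSupport u →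
        (∃ B : ℝ, ∀ x ∈ frontier Ω, u x ≤ B) →
        ∀ a : ℤ → ℝ≥0∞,
          (∀ i : ℤ, a i = μH[(n:ℝ)] {x ∈ frontier Ω | (2:ℝ) ^ i < u x}) →
          (c : ℝ≥0∞) * ∑' i : ℤ,
              (2:ℝ≥0∞) ^ (p * i) * a i ^ (((n:ℝ) - s*p)/(n:ℝ))
            ≤ (1/2) * (∫⁻ x in frontier Ω, ∫⁻ y in frontier Ω,
                  (‖u x - u y‖₊ : ℝ≥0∞) ^ p / (‖x - y‖₊ : ℝ≥0∞) ^ ((n:ℝ) + s*p)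
                    ∂μH[(n:ℝ)] ∂μH[(n:ℝ)])
              + ∫⁻ x in frontier Ω,
                  (fracMeanCurv n α Ω x) ^ (s*p/α) * (‖u x‖₊ : ℝ≥0∞) ^ p ∂μH[(n:ℝ)] := by
  obtain ⟨hα0, -⟩ := hα
  obtain ⟨hs0, -⟩ := hs
  have hn' : (0:ℝ) < n := by exact_mod_cast hn
  have hp0 : 0 < p := by linarith
  have hq : 0 < s * p := by positivity
  set q := s * p with hqdef
  set θ := q / n with hθ
  have hθ0 : 0 < θ := by positivity
  have hθ1 : θ < 1 := (div_lt_one hn').2 hsp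
  have hexp : ((n:ℝ) - q)/n = 1 - θ := by rw [hθ]; field_simp
  rw [hexp]
  obtain ⟨c₁, hc₁, hkey⟩ := key_a n hn α q hα0 hq
  obtain ⟨C, hC, hseq⟩ := seq_le p θ hθ0 hθ1
  refine ⟨c₁ / (4 * C), by positivity, ?_⟩
  intro Ω ho hcv u hu hu0 hsupp ⟨B, hB⟩ a ha
  set σ : Measure (EuclideanSpace ℝ (Fin (n+1))) := (μH[(n:ℝ)]).restrict (frontier Ω) with hσ
  have hfm : MeasurableSet (frontier Ω) := isClosed_frontier.measurableSet
  have hlf : IsLocallyFiniteMeasure σ := ⟨fun x => ⟨ball x 1, ball_mem_nhds x one_pos, by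
    rw [hσ, Measure.restrict_apply measurableSet_ball, Set.inter_comm]
    exact fin_frontier ho hcv x 1⟩⟩
  set E : ℤ → Set (EuclideanSpace ℝ (Fin (n+1))) := fun k => {x | (2:ℝ) ^ k < u x} with hE
  have hEm : ∀ k, MeasurableSet (E k) := fun k => measurableSet_lt measurable_const hu
  have haσ : ∀ k, a k = σ (E k) := by
    intro k
    rw [ha k, hσ, Measure.restrict_apply (hEm k)]
    congr 1; ext x; exact and_comm
  have hEmono : ∀ j k, j ≤ k → E k ⊆ E j := fun j k hjk x hx =>
    lt_of_le_of_lt (zpow_le_zpow_right₀ (one_le_two : (1:ℝ) ≤ 2) hjk) hx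
  have hamono : ∀ j k, j ≤ k → a k ≤ a j := fun j k hjk => by
    rw [haσ, haσ]; exact measure_mono (hEmono j k hjk)
  -- finiteness
  have hA : ∀ k, a k ≤ σ (tsupport u) := by
    intro k
    rw [haσ]
    refine measure_mono fun x hx => subset_tsupport u ?_
    have : (0:ℝ) < 2 ^ k := by positivity
    exact (this.trans hx).ne'
  have hAfin : σ (tsupport u) ≠ ∞ := hsupp.isCompact.measure_lt_top.ne
  have hafin : ∀ k, a k ≠ ∞ := fun k => ((hA k).trans_lt hAfin.lt_top).ne
  obtain ⟨K, hK⟩ : ∃ K : ℤ, ∀ k, K < k → a k = 0 := by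
    obtain ⟨N, hN⟩ := pow_unbounded_of_one_lt B (one_lt_two : (1:ℝ) < 2)
    refine ⟨N, fun k hk => ?_⟩
    rw [ha k]
    have : {x ∈ frontier Ω | (2:ℝ) ^ k < u x} = ∅ := by
      ext x
      simp only [Set.mem_setOf_eq, Set.mem_empty_iff_false, iff_false, not_and, not_lt]
      intro hx
      have h1 : (2:ℝ) ^ (N:ℤ) ≤ 2 ^ k := zpow_le_zpow_right₀ (by norm_num) hk.le
      rw [zpow_natCast] at h1
      linarith [hB x hx]
    rw [this, measure_empty]
  have h1θ : 0 < 1 - θ := by linarith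
  have hS : ∑' k : ℤ, (2:ℝ≥0∞) ^ (p * (k:ℝ)) * a k ^ (1 - θ) ≠ ∞ := by
    refine ((geo_sum _ K (2 ^ (p * (K:ℝ)) * σ (tsupport u) ^ (1 - θ)) ?_ ?_).trans_lt ?_).ne
    · intro k hk
      rw [hK k hk, ENNReal.zero_rpow_of_pos h1θ, mul_zero]
    · intro m
      calc _ ≤ (2 ^ (p * (K:ℝ)) * 2⁻¹ ^ m) * σ (tsupport u) ^ (1 - θ) := by
            gcongr
            · exact two_geo hp K m
            · exact hA _
        _ = _ := by ring
    · refine (ENNReal.mul_ne_top (by norm_num) (ENNReal.mul_ne_top (ENNReal.rpow_ne_top_of_ne_zero (by norm_num) (by norm_num)) ?_)).lt_top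
      exact ENNReal.rpow_ne_top_of_nonneg h1θ.le hAfin
  have hST := hseq a (fun k => hamono _ _ (by omega)) hafin hS
  set S := ∑' k : ℤ, (2:ℝ≥0∞) ^ (p * (k:ℝ)) * a k ^ (1 - θ) with hSd
  set T := ∑' k : ℤ, (2:ℝ≥0∞) ^ (p * (k:ℝ)) * (a k ^ (-θ) * a (k+1)) with hTd
  -- pointwise
  set F1 : EuclideanSpace ℝ (Fin (n+1)) → ℝ≥0∞ := fun x =>
    ∫⁻ y, (‖u x - u y‖₊ : ℝ≥0∞) ^ p / (‖x - y‖₊ : ℝ≥0∞) ^ ((n:ℝ) + q) ∂σ with hF1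
  set F2 : EuclideanSpace ℝ (Fin (n+1)) → ℝ≥0∞ := fun x =>
    (fracMeanCurv n α Ω x) ^ (q/α) * (‖u x‖₊ : ℝ≥0∞) ^ p with hF2
  have hF1m : Measurable F1 := by
    have : Measurable (fun z : EuclideanSpace ℝ (Fin (n+1)) × EuclideanSpace ℝ (Fin (n+1)) =>
        (‖u z.1 - u z.2‖₊ : ℝ≥0∞) ^ p / (‖z.1 - z.2‖₊ : ℝ≥0∞) ^ ((n:ℝ) + q)) := by
      fun_prop
    exact this.lintegral_prod_right'
  set b : ℤ → ℝ≥0∞ := fun k => (2:ℝ≥0∞) ^ (p * (k:ℝ)) * a k ^ (-θ) with hb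
  have hlev : ∀ x ∈ frontier Ω, ∀ k : ℤ, x ∈ E (k+1) → c₁ * b k ≤ F1 x + F2 x := by
    intro x hx k hxk
    have h2k : (0:ℝ) < 2 ^ k := by positivity
    have hux : (2:ℝ) ^ k + 2 ^ k < u x := by
      have : (2:ℝ) ^ (k+1) < u x := hxk
      rw [zpow_add_one₀ (by norm_num)] at this; linarith
    have hk := hkey Ω ho hcv x hx (frontier Ω ∩ E k) (hfm.inter (hEm k))
    have hak : μH[(n:ℝ)] (frontier Ω ∩ E k) = a k := (ha k).symm
    rw [hak, Set.diff_self_inter] at hk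
    have hg2 : (fracMeanCurv n α Ω x) ^ (q/α) * 2 ^ (p * (k:ℝ)) ≤ F2 x := by
      simp only [hF2]
      gcongr
      rw [two_eq]
      apply ENNReal.rpow_le_rpow _ hp0.le
      rw [← enorm_eq_nnnorm, ← ofReal_norm]
      apply ENNReal.ofReal_le_ofReal
      rw [Real.norm_of_nonneg (hu0 x)]; linarith
    have hg1 : (∫⁻ y in frontier Ω \ E k, ((‖x - y‖₊ : ℝ≥0∞) ^ ((n:ℝ) + q))⁻¹ ∂μH[(n:ℝ)]) * 2 ^ (p * (k:ℝ)) ≤ F1 x := by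
      rw [← lintegral_mul_const _ (by fun_prop)]
      calc _ ≤ ∫⁻ y in frontier Ω \ E k, (‖u x - u y‖₊ : ℝ≥0∞) ^ p / (‖x - y‖₊ : ℝ≥0∞) ^ ((n:ℝ) + q) ∂μH[(n:ℝ)] := by
            refine setLIntegral_mono' (hfm.diff (hEm k)) fun y hy => ?_
            rw [ENNReal.div_eq_inv_mul]
            gcongr
            rw [two_eq]
            apply ENNReal.rpow_le_rpow _ hp0.le
            rw [← enorm_eq_nnnorm, ← ofReal_norm]
            apply ENNReal.ofReal_le_ofReal
            have : u y ≤ 2 ^ k := not_lt.1 hy.2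
            rw [Real.norm_eq_abs]
            exact le_trans (by linarith) (le_abs_self _)
        _ ≤ _ := lintegral_mono_set Set.diff_subset
    calc c₁ * b k = c₁ * a k ^ (-θ) * 2 ^ (p * (k:ℝ)) := by rw [hb]; ring
      _ ≤ _ := mul_le_mul_left hk _
      _ ≤ F2 x + F1 x := by rw [add_mul]; exact add_le_add hg2 hg1
      _ = _ := add_comm _ _
  have hbm : ∀ L : ℤ, ∀ m : ℕ, b (L - m) ≤ b L * 2⁻¹ ^ m := by
    intro L m
    calc _ ≤ (2 ^ (p * (L:ℝ)) * 2⁻¹ ^ m) * a L ^ (-θ) := by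
          simp only [hb]
          refine mul_le_mul' (two_geo hp L m) ?_
          rw [ENNReal.rpow_neg, ENNReal.rpow_neg]
          exact ENNReal.inv_le_inv.2 (ENNReal.rpow_le_rpow (hamono _ _ (by omega)) hθ0.le)
      _ = _ := by simp only [hb]; ring
  set g : EuclideanSpace ℝ (Fin (n+1)) → ℝ≥0∞ := fun x => ∑' k : ℤ, (E (k+1)).indicator (fun _ => b k) x with hg
  have hgF : ∀ x ∈ frontier Ω, c₁ * g x ≤ 2 * (F1 x + F2 x) := by
    intro x hx
    rcases (hu0 x).eq_or_lt with h0 | h0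
    · have : g x = 0 := by
        simp only [hg, ENNReal.tsum_eq_zero]
        intro k
        apply Set.indicator_of_notMem
        have : (0:ℝ) < 2 ^ (k+1) := by positivity
        simp only [hE, Set.mem_setOf_eq, ← h0]
        exact not_lt.2 this.le
      rw [this, mul_zero]; exact zero_le
    · obtain ⟨L, hL1, hL2⟩ := exists_mem_Ioc_zpow h0 (one_lt_two : (1:ℝ) < 2)
      -- 2^L < u x ≤ 2^(L+1)
      have hgb : g x ≤ 2 * b (L-1) := by
        refine geo_sum _ (L-1) (b (L-1)) ?_ ?_
        · intro k hk
          apply Set.indicator_of_notMem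
          have : (2:ℝ) ^ (L+1) ≤ 2 ^ (k+1) := zpow_le_zpow_right₀ (by norm_num) (by omega)
          simp only [hE, Set.mem_setOf_eq]
          linarith
        · intro m
          exact (Set.indicator_le_self _ _ _).trans (hbm (L-1) m)
      have h3 := hlev x hx (L-1) (by simpa [hE] using hL1)
      calc c₁ * g x ≤ c₁ * (2 * b (L-1)) := by gcongr
        _ = 2 * (c₁ * b (L-1)) := by ring
        _ ≤ _ := by gcongr
  have hgint : ∫⁻ x, g x ∂σ = T := by
    simp only [hg]
    rw [lintegral_tsum (fun k => (measurable_const.indicator (hEm _)).aemeasurable), hTd]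
    congr 1; funext k
    rw [lintegral_indicator (hEm _), setLIntegral_const, ← haσ, hb, mul_assoc]
  have hmain : c₁ * T ≤ 2 * (∫⁻ x, F1 x ∂σ + ∫⁻ x, F2 x ∂σ) := by
    rw [← hgint, ← lintegral_const_mul' _ _ ENNReal.coe_ne_top, ← lintegral_add_left hF1m,
      ← lintegral_const_mul' _ _ (by norm_num)]
    exact setLIntegral_mono' hfm hgF
  have hcc : ((c₁ / (4 * C) : ℝ≥0) : ℝ≥0∞) * C = 4⁻¹ * c₁ := by
    have h4 : ((4⁻¹ : ℝ≥0) : ℝ≥0∞) = 4⁻¹ := by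
      rw [ENNReal.coe_inv (by norm_num)]; norm_num
    rw [← ENNReal.coe_mul, show c₁ / (4 * C) * C = 4⁻¹ * c₁ by field_simp, ENNReal.coe_mul, h4]
  calc ((c₁ / (4 * C) : ℝ≥0) : ℝ≥0∞) * S ≤ (c₁ / (4 * C) : ℝ≥0) * (C * T) := by gcongr
    _ = 4⁻¹ * (c₁ * T) := by rw [← mul_assoc, hcc, mul_assoc]
    _ ≤ 4⁻¹ * (2 * (∫⁻ x, F1 x ∂σ + ∫⁻ x, F2 x ∂σ)) := by gcongr
    _ = 1/2 * ∫⁻ x, F1 x ∂σ + 1/2 * ∫⁻ x, F2 x ∂σ := by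
      have : (4⁻¹ : ℝ≥0∞) * 2 = 1/2 := by
        rw [show (4:ℝ≥0∞) = 2 * 2 by norm_num, ENNReal.mul_inv (by norm_num) (by norm_num), mul_assoc,
          ENNReal.inv_mul_cancel (by norm_num) (by norm_num)]; simp
      rw [← mul_assoc, this, mul_add]
    _ ≤ _ := by
      gcongr
      exact mul_le_of_le_one_left zero_le (by simp)
end
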